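/- Let 0 < ε < 1 and let 𝒮 be a martingale ε-sparse family of subintervals of [0,1). Let K ∈ 𝐊, let L be any subinterval of K, and set J := K^m. There exists a constant C(p) > 0, depending only on p and independent of k, ε, 𝒮, L, K, and the choices of the intervals I(J), such that: (a) Σ ⟨w_k⟩_I^p·⟨σ_k⟩_I·|I| ≤ C(p)·k·w_k(L)/(1−ε) and Σ ⟨σ_k⟩_I^{p'}·⟨w_k⟩_I·|I| ≤ C(p)·k·σ_k(L)/(1−ε), where both sums run over I ∈ 𝒮 with I ⊆ L and |I| ≥ (1/3 − 3^{−k})·|I(J)|; (b) the same two bounds hold when the sums run over I ∈ 𝒮 with I ⊆ L such that I is not contained in any member of ch_𝐊(K). Here p' := p/(p−1). -/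

import Mathlib

open MeasureTheory Set Filter

noncomputable section

namespace RTpaper

/-- The half-open interval `[a, b)` represented by the pair `(a, b)`. -/
def ivSet (I : ℝ × ℝ) : Set ℝ := Set.Ico I.1 I.2

/-- The length of the interval represented by `I`. -/
def len (I : ℝ × ℝ) : ℝ := I.2 - I.1

/-- The middle triadic child of an interval. -/
def mid (I : ℝ × ℝ) : ℝ × ℝ := (I.1 + (I.2 - I.1) / 3, I.2 - (I.2 - I.1) / 3)

/-- The families `𝐊ᵢ` of the Reguera–Thiele construction. -/
def Kfam (k : ℕ) : ℕ → Set (ℝ × ℝ)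
  | 0 => {((0 : ℝ), (1 : ℝ))}
  | (i + 1) =>
      {I | ∃ K ∈ Kfam k i, ∃ j : ℕ, j < 3 ^ (k - 1) ∧
        I = ((mid K).1 + (j : ℝ) * ((3 : ℝ) ^ (1 - (k : ℤ)) * len (mid K)),
             (mid K).1 + ((j : ℝ) + 1) * ((3 : ℝ) ^ (1 - (k : ℤ)) * len (mid K)))}

/-- The families `𝐉ᵢ` (of interest for `i ≥ 1`). -/
def Jfam (k i : ℕ) : Set (ℝ × ℝ) := {J | ∃ K ∈ Kfam k (i - 1), J = mid K}

/-- The family `𝐊 = ⋃ᵢ 𝐊ᵢ`. -/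
def KK (k : ℕ) : Set (ℝ × ℝ) := ⋃ i, Kfam k i

/-- The family `𝐉 = ⋃_{i ≥ 1} 𝐉ᵢ`. -/
def JJ (k : ℕ) : Set (ℝ × ℝ) := ⋃ i, Jfam k (i + 1)

/-- The chosen triadic interval `I(J)` adjacent to `J` of length `3^{1-k}|J|`, encoded by a
choice function `ch` deciding, for each `J`, whether `I(J)` lies to the right (`true`) or to
the left (`false`) of `J`. -/
def IJ (k : ℕ) (ch : ℝ × ℝ → Bool) (J : ℝ × ℝ) : ℝ × ℝ :=
  if ch J then (J.2, J.2 + (3 : ℝ) ^ (1 - (k : ℤ)) * len J)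
  else (J.1 - (3 : ℝ) ^ (1 - (k : ℤ)) * len J, J.1)

/-- The weight `w_k = Σ_{i ≥ 1} Σ_{J ∈ 𝐉ᵢ} (3^k/(3^{k-1}+1))^i · 1_{I(J)}`. -/
def wgt (k : ℕ) (ch : ℝ × ℝ → Bool) (x : ℝ) : ℝ :=
  ∑' i : ℕ, ∑' J : ↥(Jfam k (i + 1)),
    Set.indicator (ivSet (IJ k ch (J : ℝ × ℝ)))
      (fun _ => ((3 : ℝ) ^ k / ((3 : ℝ) ^ (k - 1) + 1)) ^ (i + 1)) x

/-- The weight `σ_k = w_k^{1-p}` on `{w_k > 0}`, and `0` elsewhere. -/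
def sgm (p : ℝ) (k : ℕ) (ch : ℝ × ℝ → Bool) (x : ℝ) : ℝ :=
  if 0 < wgt k ch x then wgt k ch x ^ (1 - p) else 0

/-- `u(I) = ∫_I u`. -/
def mass (u : ℝ → ℝ) (I : ℝ × ℝ) : ℝ := ∫ x in ivSet I, u x

/-- `⟨u⟩_I = u(I)/|I|`. -/
def avg (u : ℝ → ℝ) (I : ℝ × ℝ) : ℝ := mass u I / len I

/-- `ch_𝐊(K)`: the members of `𝐊_{i+1}` contained in `K ∈ 𝐊ᵢ`. -/
def chK (k : ℕ) (K : ℝ × ℝ) : Set (ℝ × ℝ) :=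
  {K' | ∃ i, K ∈ Kfam k i ∧ K' ∈ Kfam k (i + 1) ∧ ivSet K' ⊆ ivSet K}

/-- Triadic intervals of `ℝ`. -/
def IsTriadic (I : ℝ × ℝ) : Prop :=
  ∃ n j : ℤ, I.1 = (j : ℝ) * (3 : ℝ) ^ (-n) ∧ I.2 = ((j : ℝ) + 1) * (3 : ℝ) ^ (-n)

/-- Maximal members of `S` strictly contained in `R`. -/
def maxIn (S : Set (ℝ × ℝ)) (R : ℝ × ℝ) : Set (ℝ × ℝ) :=
  {Q | Q ∈ S ∧ ivSet Q ⊂ ivSet R ∧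
    ∀ Q' ∈ S, ivSet Q ⊆ ivSet Q' → ivSet Q' ⊂ ivSet R → ivSet Q' = ivSet Q}

/-- Martingale `ε`-sparse families of (half-open) intervals. -/
def MSparse (ε : ℝ) (S : Set (ℝ × ℝ)) : Prop :=
  S.Countable ∧ (∀ I ∈ S, I.1 < I.2) ∧
    (∀ I ∈ S, ∀ J ∈ S, ivSet I ⊆ ivSet J ∨ ivSet J ⊆ ivSet I ∨ ivSet I ∩ ivSet J = ∅) ∧
    ∀ R ∈ S, (∑' Q : ↥(maxIn S R), len (Q : ℝ × ℝ)) ≤ ε * len R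

/-- `Σ_{I ∈ F} ⟨u⟩_I^q · ⟨v⟩_I · |I|`. -/
def sumTest (q : ℝ) (u v : ℝ → ℝ) (F : Set (ℝ × ℝ)) : ℝ :=
  ∑' I : ↥F, avg u (I : ℝ × ℝ) ^ q * avg v (I : ℝ × ℝ) * len (I : ℝ × ℝ)


lemma chain_count (T : Finset ℝ) (ε δ M : ℝ) (hε : 0 < ε) (hε1 : ε < 1) (hδ : 0 < δ) (hM : δ ≤ M)
    (h : ∀ y ∈ T, δ ≤ y ∧ y ≤ M) (hr : ∀ y ∈ T, ∀ z ∈ T, y < z → y ≤ ε * z) :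
    (T.card : ℝ) ≤ 2 + Real.log (M / δ) / (1 - ε) := by
  have h1 : 0 < 1 - ε := by linarith
  have key : ∀ y ∈ T, ∀ z ∈ T, y < z → ⌊Real.log y / (1 - ε)⌋ < ⌊Real.log z / (1 - ε)⌋ := by
    intro y hy z hz hyz
    have hy0 : 0 < y := lt_of_lt_of_le hδ (h y hy).1
    have hz0 : 0 < z := lt_of_lt_of_le hδ (h z hz).1
    have e1 : Real.log y ≤ Real.log ε + Real.log z := by
      rw [← Real.log_mul hε.ne' hz0.ne']
      exact Real.log_le_log hy0 (hr y hy z hz hyz)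
    have e2 := Real.log_le_sub_one_of_pos hε
    have e3 : Real.log y / (1 - ε) + 1 ≤ Real.log z / (1 - ε) := by
      rw [div_add_one h1.ne']
      gcongr
      linarith
    have e4 := Int.floor_le_floor e3
    rw [Int.floor_add_one] at e4
    omega
  have hinj : Set.InjOn (fun y : ℝ => ⌊Real.log y / (1 - ε)⌋) T := by
    intro y hy z hz hyz
    by_contra hne
    rcases lt_or_gt_of_ne hne with hl | hl
    · exact absurd hyz (key y hy z hz hl).ne
    · exact absurd hyz (key z hz y hy hl).ne'
  have hmap : ∀ y ∈ T, (fun y : ℝ => ⌊Real.log y / (1 - ε)⌋) y ∈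
      Finset.Icc ⌊Real.log δ / (1 - ε)⌋ ⌊Real.log M / (1 - ε)⌋ := by
    intro y hy
    have hy0 : 0 < y := lt_of_lt_of_le hδ (h y hy).1
    simp only [Finset.mem_Icc]
    constructor
    · apply Int.floor_le_floor
      gcongr
      exact (h y hy).1
    · apply Int.floor_le_floor
      gcongr
      exact (h y hy).2
  have hc := Finset.card_le_card_of_injOn _ hmap hinj
  rw [Int.card_Icc] at hc
  have hle : ⌊Real.log δ / (1 - ε)⌋ ≤ ⌊Real.log M / (1 - ε)⌋ := by
    apply Int.floor_le_floor
    gcongr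
  have hc2 : (T.card : ℤ) ≤ ⌊Real.log M / (1 - ε)⌋ + 1 - ⌊Real.log δ / (1 - ε)⌋ := by omega
  have hc3 : (T.card : ℝ) ≤ ⌊Real.log M / (1 - ε)⌋ + 1 - ⌊Real.log δ / (1 - ε)⌋ := by
    exact_mod_cast hc2
  have f1 := Int.floor_le (Real.log M / (1 - ε))
  have f2 := Int.lt_floor_add_one (Real.log δ / (1 - ε))
  rw [Real.log_div (by linarith) hδ.ne', sub_div]
  linarith

lemma chain_sum_inv (ε : ℝ) (hε : 0 < ε) (hε1 : ε < 1) (T : Finset ℝ) : ∀ δ : ℝ, 0 < δ →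
    (∀ y ∈ T, δ ≤ y) → (∀ y ∈ T, ∀ z ∈ T, y < z → y ≤ ε * z) →
    ∑ y ∈ T, 1 / y ≤ 1 / (δ * (1 - ε)) := by
  have h1 : 0 < 1 - ε := by linarith
  induction T using Finset.induction_on_min with
  | empty =>
    intro δ hδ _ _
    simp only [Finset.sum_empty]
    positivity
  | insert m s hm ih =>
    intro δ hδ hle hr
    have hms : m ∉ s := fun h => lt_irrefl _ (hm m h)
    rw [Finset.sum_insert hms]
    have hm0 : δ ≤ m := hle m (Finset.mem_insert_self _ _)
    have hmpos : 0 < m := by linarith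
    have := ih (m / ε) (by positivity) (fun y hy => by
      rw [div_le_iff₀ hε]
      have := hr m (Finset.mem_insert_self _ _) y (Finset.mem_insert_of_mem hy) (hm y hy)
      linarith) (fun y hy z hz => hr y (Finset.mem_insert_of_mem hy) z (Finset.mem_insert_of_mem hz))
    have e : 1 / m + 1 / (m / ε * (1 - ε)) = 1 / (m * (1 - ε)) := by
      field_simp
      ring
    calc _ ≤ 1 / m + 1 / (m / ε * (1 - ε)) := by linarith
      _ = _ := e
      _ ≤ _ := by gcongr

lemma chain_sum (ε : ℝ) (hε : 0 < ε) (hε1 : ε < 1) (T : Finset ℝ) : ∀ M : ℝ, 0 ≤ M →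
    (∀ y ∈ T, 0 < y ∧ y ≤ M) → (∀ y ∈ T, ∀ z ∈ T, y < z → y ≤ ε * z) →
    ∑ y ∈ T, y ≤ M / (1 - ε) := by
  have h1 : 0 < 1 - ε := by linarith
  induction T using Finset.induction_on_max with
  | empty =>
    intro δ hδ _ _
    simp only [Finset.sum_empty]
    positivity
  | insert m s hm ih =>
    intro M hM hle hr
    have hms : m ∉ s := fun h => lt_irrefl _ (hm m h)
    rw [Finset.sum_insert hms]
    have hm0 := hle m (Finset.mem_insert_self _ _)
    have hmpos : 0 < m := by linarith
    have := ih (ε * m) (by positivity) (fun y hy => ⟨(hle y (Finset.mem_insert_of_mem hy)).1,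
      hr y (Finset.mem_insert_of_mem hy) m (Finset.mem_insert_self _ _) (hm y hy)⟩)
      (fun y hy z hz => hr y (Finset.mem_insert_of_mem hy) z (Finset.mem_insert_of_mem hz))
    have e : m + ε * m / (1 - ε) = m / (1 - ε) := by
      field_simp
      ring
    calc _ ≤ m + ε * m / (1 - ε) := by linarith
      _ = _ := e
      _ ≤ _ := by gcongr; exact hm0.2

/-- Finite sparse families. -/
structure FS (ε : ℝ) (G : Finset (ℝ × ℝ)) : Prop where
  pos : ∀ I ∈ G, I.1 < I.2
  lam : ∀ I ∈ G, ∀ J ∈ G, ivSet I ⊆ ivSet J ∨ ivSet J ⊆ ivSet I ∨ ivSet I ∩ ivSet J = ∅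
  sp : ∀ R ∈ G, volume.real (⋃ Q ∈ {Q | Q ∈ G ∧ ivSet Q ⊂ ivSet R}, ivSet Q) ≤ ε * len R

lemma vol_iv {I : ℝ × ℝ} (h : I.1 ≤ I.2) : volume.real (ivSet I) = len I := by
  simp [ivSet, len, measureReal_def, Real.volume_Ico, h]

lemma iv_fin (I : ℝ × ℝ) : volume (ivSet I) ≠ ⊤ := by
  simp [ivSet, Real.volume_Ico]

lemma iv_meas (I : ℝ × ℝ) : MeasurableSet (ivSet I) := measurableSet_Ico

lemma iv_inj {I J : ℝ × ℝ} (hI : I.1 < I.2) (h : ivSet I = ivSet J) : I = J := by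
  unfold ivSet at h
  have hs : Set.Ico I.1 I.2 ⊆ Set.Ico J.1 J.2 := h.subset
  rw [Set.Ico_subset_Ico_iff hI] at hs
  have hs' : Set.Ico J.1 J.2 ⊆ Set.Ico I.1 I.2 := h.superset
  have hJ : J.1 < J.2 := by linarith
  rw [Set.Ico_subset_Ico_iff hJ] at hs'
  exact Prod.ext (le_antisymm hs'.1 hs.1) (le_antisymm hs.2 hs'.2)

lemma len_mono {I J : ℝ × ℝ} (hI : I.1 < I.2) (h : ivSet I ⊆ ivSet J) : len I ≤ len J := by
  unfold ivSet at h
  rw [Set.Ico_subset_Ico_iff hI] at h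
  unfold len
  linarith

lemma FS.ratio {ε : ℝ} {G : Finset (ℝ × ℝ)} (hG : FS ε G) {Q R : ℝ × ℝ} (hQ : Q ∈ G) (hR : R ∈ G)
    (h : ivSet Q ⊂ ivSet R) : len Q ≤ ε * len R := by
  refine le_trans ?_ (hG.sp R hR)
  rw [← vol_iv (hG.pos Q hQ).le]
  apply measureReal_mono
  · exact Set.subset_biUnion_of_mem (u := ivSet) (show Q ∈ {Q | Q ∈ G ∧ ivSet Q ⊂ ivSet R} from ⟨hQ, h⟩)
  · refine ne_top_of_le_ne_top (iv_fin R) (measure_mono ?_)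
    exact Set.iUnion₂_subset fun Q hQ => hQ.2.subset

lemma FS.chain {ε : ℝ} (hε1 : ε < 1) {G : Finset (ℝ × ℝ)} (hG : FS ε G) {x : ℝ}
    {Q R : ℝ × ℝ} (hQ : Q ∈ G) (hR : R ∈ G) (hx : x ∈ ivSet Q) (hx' : x ∈ ivSet R) :
    (len Q < len R → len Q ≤ ε * len R) ∧ (len Q = len R → Q = R) := by
  have pQ : 0 < len Q := sub_pos.2 (hG.pos Q hQ)
  have pR : 0 < len R := sub_pos.2 (hG.pos R hR)
  by_cases he : ivSet Q = ivSet R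
  · have := iv_inj (hG.pos Q hQ) he
    subst this
    simp
  rcases hG.lam Q hQ R hR with h | h | h
  · have := hG.ratio hQ hR (h.ssubset_of_ne he)
    refine ⟨fun _ => this, fun h' => ?_⟩
    nlinarith
  · have := hG.ratio hR hQ (h.ssubset_of_ne (Ne.symm he))
    refine ⟨fun _ => by nlinarith, fun h' => ?_⟩
    nlinarith
  · exact absurd (show x ∈ ivSet Q ∩ ivSet R from ⟨hx, hx'⟩) (by simp [h])

lemma FS.pack {ε : ℝ} (hε1 : ε < 1) {G : Finset (ℝ × ℝ)} (hG : FS ε G) (A : Set ℝ)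
    (hA : volume A ≠ ⊤) (G' : Finset (ℝ × ℝ)) (hG' : G' ⊆ G) (hs : ∀ I ∈ G', ivSet I ⊆ A) :
    ∑ I ∈ G', len I ≤ volume.real A / (1 - ε) := by
  have h1 : 0 < 1 - ε := by linarith
  set E : ℝ × ℝ → Set ℝ := fun R => ivSet R \ (⋃ Q ∈ {Q | Q ∈ G ∧ ivSet Q ⊂ ivSet R}, ivSet Q)
    with hE
  have hUm : ∀ R, MeasurableSet (⋃ Q ∈ {Q | Q ∈ G ∧ ivSet Q ⊂ ivSet R}, ivSet Q) := by
    intro R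
    refine MeasurableSet.biUnion ?_ (fun Q _ => iv_meas Q)
    exact (G.finite_toSet.subset (fun Q hQ => hQ.1)).countable
  have hEm : ∀ R, MeasurableSet (E R) := fun R => (iv_meas R).diff (hUm R)
  have hEv : ∀ R ∈ G, (1 - ε) * len R ≤ volume.real (E R) := by
    intro R hR
    have hsub : (⋃ Q ∈ {Q | Q ∈ G ∧ ivSet Q ⊂ ivSet R}, ivSet Q) ⊆ ivSet R :=
      Set.iUnion₂_subset fun Q hQ => hQ.2.subset
    rw [hE, measureReal_sdiff hsub (hUm R) (iv_fin R), vol_iv (hG.pos R hR).le]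
    have := hG.sp R hR
    linarith
  have hdis : Set.PairwiseDisjoint (↑G') E := by
    intro I hI J hJ hne
    have hI := hG' hI
    have hJ := hG' hJ
    rw [Function.onFun, Set.disjoint_left]
    rintro x ⟨hxI, hxI'⟩ ⟨hxJ, hxJ'⟩
    have hne' : ivSet I ≠ ivSet J := fun h => hne (iv_inj (hG.pos I hI) h)
    rcases hG.lam I hI J hJ with h | h | h
    · apply hxJ'
      simp only [Set.mem_iUnion]
      exact ⟨I, ⟨hI, h.ssubset_of_ne hne'⟩, hxI⟩
    · apply hxI'
      simp only [Set.mem_iUnion]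
      exact ⟨J, ⟨hJ, h.ssubset_of_ne hne'.symm⟩, hxJ⟩
    · exact absurd (show x ∈ ivSet I ∩ ivSet J from ⟨hxI, hxJ⟩) (by simp [h])
  rw [le_div_iff₀ h1, Finset.sum_mul]
  calc ∑ I ∈ G', len I * (1 - ε) ≤ ∑ I ∈ G', volume.real (E I) :=
        Finset.sum_le_sum fun I hI => by have := hEv I (hG' hI); linarith
    _ = volume.real (⋃ I ∈ G', E I) := by
        rw [measureReal_biUnion_finset hdis (fun I _ => hEm I)
          (fun I _ => ne_top_of_le_ne_top (iv_fin I) (measure_mono Set.sdiff_subset))]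
    _ ≤ volume.real A := by
        apply measureReal_mono _ hA
        exact Set.iUnion₂_subset fun I hI => Set.sdiff_subset.trans (hs I hI)

lemma FS.count {ε : ℝ} (hε : 0 < ε) (hε1 : ε < 1) {G : Finset (ℝ × ℝ)} (hG : FS ε G) (x δ M : ℝ)
    (hδ : 0 < δ) (hM : δ ≤ M) (G' : Finset (ℝ × ℝ)) (hG' : G' ⊆ G)
    (hs : ∀ I ∈ G', x ∈ ivSet I ∧ δ ≤ len I ∧ len I ≤ M) :
    (G'.card : ℝ) ≤ 2 + Real.log (M / δ) / (1 - ε) := by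
  have hinj : Set.InjOn len (G' : Set (ℝ × ℝ)) := fun I hI J hJ h =>
    (hG.chain hε1 (hG' hI) (hG' hJ) (hs I hI).1 (hs J hJ).1).2 h
  rw [← Finset.card_image_of_injOn hinj]
  apply chain_count _ _ _ _ hε hε1 hδ hM
  · intro y hy
    obtain ⟨I, hI, rfl⟩ := Finset.mem_image.1 hy
    exact (hs I hI).2
  · intro y hy z hz
    obtain ⟨I, hI, rfl⟩ := Finset.mem_image.1 hy
    obtain ⟨J, hJ, rfl⟩ := Finset.mem_image.1 hz
    exact (hG.chain hε1 (hG' hI) (hG' hJ) (hs I hI).1 (hs J hJ).1).1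

lemma FS.chain2 {ε : ℝ} (hε : 0 < ε) (hε1 : ε < 1) {G : Finset (ℝ × ℝ)} (hG : FS ε G) (x d : ℝ)
    (hd : 0 < d) (G' : Finset (ℝ × ℝ)) (hG' : G' ⊆ G)
    (hs : ∀ I ∈ G', x ∈ ivSet I) :
    ∑ I ∈ G', min (len I) (d ^ 2 / len I) ≤ 2 * d / (1 - ε) := by
  have h1 : 0 < 1 - ε := by linarith
  have hinj : Set.InjOn len (G' : Set (ℝ × ℝ)) := fun I hI J hJ h =>
    (hG.chain hε1 (hG' hI) (hG' hJ) (hs I hI) (hs J hJ)).2 h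
  rw [← Finset.sum_image (f := fun y => min y (d ^ 2 / y)) hinj]
  set T := Finset.image len G' with hT
  have hpos : ∀ y ∈ T, 0 < y := by
    intro y hy
    obtain ⟨I, hI, rfl⟩ := Finset.mem_image.1 hy
    exact sub_pos.2 (hG.pos I (hG' hI))
  have hr : ∀ y ∈ T, ∀ z ∈ T, y < z → y ≤ ε * z := by
    intro y hy z hz
    obtain ⟨I, hI, rfl⟩ := Finset.mem_image.1 hy
    obtain ⟨J, hJ, rfl⟩ := Finset.mem_image.1 hz
    exact (hG.chain hε1 (hG' hI) (hG' hJ) (hs I hI) (hs J hJ)).1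
  rw [← Finset.sum_filter_add_sum_filter_not T (fun y => y ≤ d)]
  have a1 : ∑ y ∈ T with y ≤ d, min y (d ^ 2 / y) ≤ d / (1 - ε) := by
    refine le_trans (Finset.sum_le_sum fun y _ => min_le_left _ _) ?_
    apply chain_sum ε hε hε1 _ d hd.le
    · intro y hy
      rw [Finset.mem_filter] at hy
      exact ⟨hpos y hy.1, hy.2⟩
    · intro y hy z hz
      exact hr y (Finset.mem_filter.1 hy).1 z (Finset.mem_filter.1 hz).1
  have a2 : ∑ y ∈ T with ¬ y ≤ d, min y (d ^ 2 / y) ≤ d / (1 - ε) := by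
    refine le_trans (Finset.sum_le_sum fun y _ => min_le_right _ _) ?_
    have := chain_sum_inv ε hε hε1 (T.filter fun y => ¬ y ≤ d) d hd (by
      intro y hy
      rw [Finset.mem_filter] at hy
      linarith [hy.2]) (by
      intro y hy z hz
      exact hr y (Finset.mem_filter.1 hy).1 z (Finset.mem_filter.1 hz).1)
    calc _ = d ^ 2 * ∑ y ∈ T with ¬ y ≤ d, 1 / y := by
            rw [Finset.mul_sum]; exact Finset.sum_congr rfl fun y _ => by ring
      _ ≤ d ^ 2 * (1 / (d * (1 - ε))) := by gcongr
      _ = _ := by field_simp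
  calc _ ≤ d / (1 - ε) + d / (1 - ε) := add_le_add a1 a2
    _ = _ := by ring

/-- the Carleson-type sum -/
lemma FS.carl {ε : ℝ} (hε : 0 < ε) (hε1 : ε < 1) {G : Finset (ℝ × ℝ)} (hG : FS ε G) (α β : ℝ)
    (G' : Finset (ℝ × ℝ)) (hG' : G' ⊆ G) :
    ∑ I ∈ G', (volume.real (ivSet I ∩ Set.Ico α β) / len I) ^ 2 * len I ≤
      5 * volume.real (Set.Ico α β) / (1 - ε) := by
  classical
  have h1 : 0 < 1 - ε := by linarith
  rcases le_or_gt β α with hab | hab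
  · simp [Set.Ico_eq_empty (not_lt.2 hab)]
  set d := volume.real (Set.Ico α β) with hd
  have hd' : d = β - α := by simp [hd, measureReal_def, Real.volume_Ico, hab.le]
  have hd0 : 0 < d := by rw [hd']; linarith
  have hfin : volume (Set.Ico α β) ≠ ⊤ := by simp [Real.volume_Ico]
  have hterm : ∀ I ∈ G', (volume.real (ivSet I ∩ Set.Ico α β) / len I) ^ 2 * len I ≤
      min (len I) (d ^ 2 / len I) := by
    intro I hI
    have p : 0 < len I := sub_pos.2 (hG.pos I (hG' hI))
    have m1 : volume.real (ivSet I ∩ Set.Ico α β) ≤ len I := by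
      rw [← vol_iv (hG.pos I (hG' hI)).le]
      exact measureReal_mono Set.inter_subset_left (iv_fin I)
    have m2 : volume.real (ivSet I ∩ Set.Ico α β) ≤ d := measureReal_mono Set.inter_subset_right hfin
    have m0 : 0 ≤ volume.real (ivSet I ∩ Set.Ico α β) := measureReal_nonneg
    have e : (volume.real (ivSet I ∩ Set.Ico α β) / len I) ^ 2 * len I =
      volume.real (ivSet I ∩ Set.Ico α β) ^ 2 / len I := by field_simp
    rw [e]
    apply le_min
    · rw [div_le_iff₀ p]; nlinarith
    · gcongr
  have hsplit : ∀ I ∈ G', (volume.real (ivSet I ∩ Set.Ico α β) / len I) ^ 2 * len I ≤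
      (if ivSet I ⊆ Set.Ico α β then len I else 0) +
      (if α ∈ ivSet I then min (len I) (d ^ 2 / len I) else 0) +
      (if β ∈ ivSet I then min (len I) (d ^ 2 / len I) else 0) := by
    intro I hI
    have p : 0 < len I := sub_pos.2 (hG.pos I (hG' hI))
    have t := hterm I hI
    have mn : 0 ≤ min (len I) (d ^ 2 / len I) := le_min p.le (by positivity)
    have n1 : 0 ≤ (if ivSet I ⊆ Set.Ico α β then len I else 0) := by split_ifs <;> linarith
    have n2 : 0 ≤ (if α ∈ ivSet I then min (len I) (d ^ 2 / len I) else 0) := by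
      split_ifs <;> linarith
    have n3 : 0 ≤ (if β ∈ ivSet I then min (len I) (d ^ 2 / len I) else 0) := by
      split_ifs <;> linarith
    by_cases c1 : ivSet I ⊆ Set.Ico α β
    · rw [if_pos c1] at n1 ⊢
      have := min_le_left (len I) (d ^ 2 / len I)
      linarith
    by_cases c2 : α ∈ ivSet I
    · rw [if_pos c2] at n2 ⊢
      linarith
    by_cases c3 : β ∈ ivSet I
    · rw [if_pos c3] at n3 ⊢
      linarith
    have : ivSet I ∩ Set.Ico α β = ∅ := by
      ext y
      simp only [Set.mem_inter_iff, Set.mem_empty_iff_false, iff_false]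
      rintro ⟨hy1, hy2⟩
      simp only [ivSet, Set.mem_Ico, not_and, not_lt] at hy1 hy2 c2 c3
      apply c1
      intro z hz
      simp only [ivSet, Set.mem_Ico] at hz ⊢
      constructor
      · by_contra hh
        have := c2 (by linarith)
        linarith
      · by_contra hh
        have := c3 (by linarith)
        linarith
    rw [this]
    simp only [measureReal_empty, zero_div]
    have : (0:ℝ) ^ 2 * len I = 0 := by ring
    rw [this]
    linarith
  refine le_trans (Finset.sum_le_sum hsplit) ?_
  rw [Finset.sum_add_distrib, Finset.sum_add_distrib, ← Finset.sum_filter, ← Finset.sum_filter,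
    ← Finset.sum_filter]
  have b1 := hG.pack hε1 (Set.Ico α β) hfin (G'.filter fun I => ivSet I ⊆ Set.Ico α β)
    ((Finset.filter_subset _ _).trans hG') (fun I hI => (Finset.mem_filter.1 hI).2)
  have b2 := hG.chain2 hε hε1 α d hd0 (G'.filter fun I => α ∈ ivSet I)
    ((Finset.filter_subset _ _).trans hG') (fun I hI => (Finset.mem_filter.1 hI).2)
  have b3 := hG.chain2 hε hε1 β d hd0 (G'.filter fun I => β ∈ ivSet I)
    ((Finset.filter_subset _ _).trans hG') (fun I hI => (Finset.mem_filter.1 hI).2)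
  calc _ ≤ d / (1 - ε) + 2 * d / (1 - ε) + 2 * d / (1 - ε) := by
        exact add_le_add (add_le_add b1 b2) b3
    _ = _ := by ring

lemma iv_eq_of_len {I J : ℝ × ℝ} (hI : I.1 < I.2) (h : ivSet I ⊆ ivSet J) (hl : len J ≤ len I) :
    ivSet J = ivSet I := by
  have h' := h
  unfold ivSet at h
  rw [Set.Ico_subset_Ico_iff hI] at h
  unfold len at hl
  have e1 : I.1 = J.1 := by linarith
  have e2 : I.2 = J.2 := by linarith
  rw [show I = J from Prod.ext e1 e2]

lemma maxIn_sum_le {ε : ℝ} {S : Set (ℝ × ℝ)} (hS : MSparse ε S) {R : ℝ × ℝ} (hR : R ∈ S)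
    (T : Finset (ℝ × ℝ)) (hT : ∀ Q ∈ T, Q ∈ maxIn S R) : ∑ Q ∈ T, len Q ≤ ε * len R := by
  classical
  obtain ⟨-, hpos, hlam, hsp⟩ := hS
  have hdis : ∀ s : Finset (ℝ × ℝ), (∀ Q ∈ s, Q ∈ maxIn S R) → ∑ Q ∈ s, len Q ≤ len R := by
    intro s hs
    have hd : Set.PairwiseDisjoint (↑s) ivSet := by
      intro Q hQ Q' hQ' hne
      have mQ := hs Q hQ
      have mQ' := hs Q' hQ'
      rw [Function.onFun, Set.disjoint_iff_inter_eq_empty]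
      rcases hlam Q mQ.1 Q' mQ'.1 with h | h | h
      · exact absurd (iv_inj (hpos _ mQ.1) (mQ.2.2 Q' mQ'.1 h mQ'.2.1).symm) hne
      · exact absurd (iv_inj (hpos _ mQ.1) (mQ'.2.2 Q mQ.1 h mQ.2.1)) hne
      · exact h
    calc ∑ Q ∈ s, len Q = ∑ Q ∈ s, volume.real (ivSet Q) :=
          Finset.sum_congr rfl fun Q hQ => (vol_iv (hpos Q (hs Q hQ).1).le).symm
      _ = volume.real (⋃ Q ∈ s, ivSet Q) :=
          (measureReal_biUnion_finset hd (fun Q _ => iv_meas Q) (fun Q _ => iv_fin Q)).symm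
      _ ≤ volume.real (ivSet R) := by
          apply measureReal_mono _ (iv_fin R)
          exact Set.iUnion₂_subset fun Q hQ => (hs Q hQ).2.1.subset
      _ = len R := vol_iv (hpos R hR).le
  have hnn : ∀ Q : ↥(maxIn S R), 0 ≤ len (Q : ℝ × ℝ) := fun Q => (sub_pos.2 (hpos _ Q.2.1)).le
  have hsum : Summable fun Q : ↥(maxIn S R) => len (Q : ℝ × ℝ) := by
    apply summable_of_sum_le hnn (c := len R)
    intro u
    have := hdis (u.map (Function.Embedding.subtype _)) (by
      intro Q hQ
      obtain ⟨Q', _, rfl⟩ := Finset.mem_map.1 hQ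
      exact Q'.2)
    rw [Finset.sum_map] at this
    exact this
  refine le_trans ?_ (hsp R hR)
  have := hsum.sum_le_tsum (T.subtype (· ∈ maxIn S R)) (fun Q _ => hnn Q)
  refine le_trans (le_of_eq ?_) this
  rw [Finset.sum_subtype_of_mem (p := (· ∈ maxIn S R)) len hT]

lemma FS_of {ε : ℝ} {S : Set (ℝ × ℝ)} (hS : MSparse ε S) (G : Finset (ℝ × ℝ))
    (hGS : ∀ I ∈ G, I ∈ S)
    (hup : ∀ I ∈ G, ∀ R ∈ G, ∀ Q ∈ S, ivSet I ⊆ ivSet Q → ivSet Q ⊂ ivSet R → Q ∈ G) : FS ε G := by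
  classical
  have hS' := hS
  obtain ⟨-, hpos, hlam, hsp⟩ := hS
  refine ⟨fun I hI => hpos I (hGS I hI), fun I hI J hJ => hlam I (hGS I hI) J (hGS J hJ), ?_⟩
  intro R hR
  refine le_trans ?_ (maxIn_sum_le hS' (hGS R hR) (G.filter (· ∈ maxIn S R))
    (fun Q hQ => (Finset.mem_filter.1 hQ).2))
  have hsub : (⋃ Q ∈ {Q | Q ∈ G ∧ ivSet Q ⊂ ivSet R}, ivSet Q) ⊆
      ⋃ Q ∈ G.filter (· ∈ maxIn S R), ivSet Q := by
    refine Set.iUnion₂_subset ?_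
    rintro Q ⟨hQ, hQR⟩
    obtain ⟨Q', hQ', hmax⟩ := Finset.exists_max_image
      (G.filter fun Q' => ivSet Q ⊆ ivSet Q' ∧ ivSet Q' ⊂ ivSet R) len
      ⟨Q, Finset.mem_filter.2 ⟨hQ, le_rfl, hQR⟩⟩
    rw [Finset.mem_filter] at hQ'
    refine hQ'.2.1.trans ?_
    refine Set.subset_biUnion_of_mem (u := ivSet) (show Q' ∈ _ from ?_)
    refine Finset.mem_coe.2 (Finset.mem_filter.2 ⟨hQ'.1, hGS _ hQ'.1, hQ'.2.2, ?_⟩)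
    intro P hP h1 h2
    have hPG := hup Q hQ R hR P hP (hQ'.2.1.trans h1) h2
    exact iv_eq_of_len (hpos _ (hGS _ hQ'.1)) h1
      (hmax P (Finset.mem_filter.2 ⟨hPG, hQ'.2.1.trans h1, h2⟩))
  refine le_trans (measureReal_mono hsub ?_) ?_
  · refine ne_top_of_le_ne_top (iv_fin R) (measure_mono ?_)
    exact Set.iUnion₂_subset fun Q hQ => (Finset.mem_filter.1 hQ).2.2.1.subset
  · refine le_trans (measureReal_biUnion_finset_le _ _) ?_
    exact Finset.sum_le_sum fun Q hQ =>
      (vol_iv (hpos Q (hGS Q (Finset.mem_filter.1 hQ).1)).le).le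

lemma sum_mass_le {ε : ℝ} (hε : 0 < ε) (hε1 : ε < 1) {G : Finset (ℝ × ℝ)} (hG : FS ε G)
    (L : ℝ × ℝ) (u : ℝ → ℝ) (hu : ∀ x, 0 ≤ u x) (hui : IntegrableOn u (ivSet L))
    (δ M : ℝ) (hδ : 0 < δ) (hM : δ ≤ M)
    (G' : Finset (ℝ × ℝ)) (hG' : G' ⊆ G) (hL : ∀ I ∈ G', ivSet I ⊆ ivSet L)
    (hs : ∀ I ∈ G', δ ≤ len I ∧ len I ≤ M) :
    ∑ I ∈ G', mass u I ≤ (2 + Real.log (M / δ) / (1 - ε)) * mass u L := by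
  classical
  have e : ∀ I ∈ G', mass u I = ∫ x in ivSet L, (ivSet I).indicator u x := by
    intro I hI
    rw [setIntegral_indicator (iv_meas I), Set.inter_eq_right.2 (hL I hI)]
    rfl
  rw [Finset.sum_congr rfl e, ← integral_finsetSum]
  · unfold mass
    rw [← integral_const_mul]
    apply integral_mono
    · exact integrable_finsetSum _ fun I hI => hui.indicator (iv_meas I)
    · exact hui.const_mul _
    · intro x
      simp only
      have : ∑ I ∈ G', (ivSet I).indicator u x = ((G'.filter fun I => x ∈ ivSet I).card : ℝ) * u x := by
        simp only [Set.indicator_apply]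
        rw [← Finset.sum_filter, Finset.sum_const, nsmul_eq_mul]
      rw [this]
      apply mul_le_mul_of_nonneg_right _ (hu x)
      apply hG.count hε hε1 x δ M hδ hM _ ((Finset.filter_subset _ _).trans hG')
      intro I hI
      rw [Finset.mem_filter] at hI
      exact ⟨hI.2, hs I hI.1⟩
  · exact fun I hI => hui.indicator (iv_meas I)

lemma mass_nonneg {u : ℝ → ℝ} (hu : ∀ x, 0 ≤ u x) (I : ℝ × ℝ) : 0 ≤ mass u I :=
  integral_nonneg hu

lemma mass_mono {u : ℝ → ℝ} (hu : ∀ x, 0 ≤ u x) {I J : ℝ × ℝ} (h : ivSet I ⊆ ivSet J)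
    (hi : IntegrableOn u (ivSet J)) : mass u I ≤ mass u J :=
  setIntegral_mono_set hi (ae_of_all _ hu) h.eventuallyLE

lemma core {ε : ℝ} (hε : 0 < ε) (hε1 : ε < 1) {S : Set (ℝ × ℝ)} (hS : MSparse ε S)
    (L : ℝ × ℝ) (u v : ℝ → ℝ) (hu : ∀ x, 0 ≤ u x) (hv : ∀ x, 0 ≤ v x)
    (hui : IntegrableOn u (ivSet L)) (hvi : IntegrableOn v (ivSet L)) (q : ℝ) (hq : 0 < q)
    (P : ℝ × ℝ → Prop)
    (hP : ∀ I ∈ S, ∀ Q ∈ S, P I → ivSet I ⊆ ivSet Q → P Q)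
    (δ M B c α β : ℝ) (hδ : 0 < δ) (hM : δ ≤ M) (hLM : len L ≤ M) (hB : 0 ≤ B) (hc : 0 ≤ c)
    (hterm : ∀ I ∈ S, ivSet I ⊆ ivSet L → P I →
      avg u I ^ q * avg v I * len I = 0 ∨
      (δ ≤ len I ∧ avg u I ^ q * avg v I * len I ≤ B * mass u I) ∨
      avg u I ^ q * avg v I * len I ≤
        c * ((volume.real (ivSet I ∩ Set.Ico α β) / len I) ^ 2 * len I))
    (hcA : c * volume.real (Set.Ico α β) ≤ mass u L) :
    sumTest q u v {I | I ∈ S ∧ ivSet I ⊆ ivSet L ∧ P I} ≤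
      (B * (2 + Real.log (M / δ) / (1 - ε)) + 5 / (1 - ε)) * mass u L := by
  classical
  have h1 : 0 < 1 - ε := by linarith
  have hmL : 0 ≤ mass u L := mass_nonneg hu L
  have hlog : 0 ≤ Real.log (M / δ) := Real.log_nonneg (by rw [le_div_iff₀ hδ]; linarith)
  have hRHS : 0 ≤ (B * (2 + Real.log (M / δ) / (1 - ε)) + 5 / (1 - ε)) * mass u L := by positivity
  set F : Set (ℝ × ℝ) := {I | I ∈ S ∧ ivSet I ⊆ ivSet L ∧ P I} with hF
  set τ : ℝ × ℝ → ℝ := fun I => avg u I ^ q * avg v I * len I with hτ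
  have hpos : ∀ I ∈ S, 0 < len I := fun I hI => sub_pos.2 (hS.2.1 I hI)
  have hτ0 : ∀ I ∈ S, 0 ≤ τ I := by
    intro I hI
    have := hpos I hI
    have a1 : 0 ≤ avg u I := div_nonneg (mass_nonneg hu I) this.le
    have a2 : 0 ≤ avg v I := div_nonneg (mass_nonneg hv I) this.le
    simp only [hτ]
    positivity
  unfold sumTest
  by_cases hsum : Summable fun I : ↥F => τ I
  swap
  · have := tsum_eq_zero_of_not_summable hsum
    simp only [hτ] at this
    rw [this]
    exact hRHS
  -- finiteness of supersets
  have hfin : ∀ I ∈ F, τ I ≠ 0 → {Q | Q ∈ F ∧ ivSet I ⊆ ivSet Q}.Finite := by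
    intro I hI hne
    have hlI := hpos I hI.1
    have hmu : 0 < mass u I := by
      rcases (mass_nonneg hu I).eq_or_lt with h | h
      · exfalso; apply hne; simp [hτ, avg, ← h, Real.zero_rpow hq.ne']
      · exact h
    have hmv : 0 < mass v I := by
      rcases (mass_nonneg hv I).eq_or_lt with h | h
      · exfalso; apply hne; simp [hτ, avg, ← h]
      · exact h
    have hLpos : 0 < len L := lt_of_lt_of_le hlI (len_mono (hS.2.1 I hI.1) hI.2.1)
    set m := (mass u I / len L) ^ q * mass v I with hm
    have hm0 : 0 < m := by positivity
    have hlow : ∀ Q ∈ F, ivSet I ⊆ ivSet Q → m ≤ τ Q := by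
      intro Q hQ hIQ
      have hlQ := hpos Q hQ.1
      have e : τ Q = (mass u Q / len Q) ^ q * mass v Q := by
        simp only [hτ, avg]
        field_simp
      rw [e, hm]
      have l1 := mass_mono hu hIQ (hui.mono_set hQ.2.1)
      have l2 := mass_mono hv hIQ (hvi.mono_set hQ.2.1)
      have l3 := len_mono (hS.2.1 Q hQ.1) hQ.2.1
      have l4 := mass_nonneg hu Q
      have l5 : 0 ≤ (mass u Q / len Q) ^ q := by positivity
      gcongr
    have ht := hsum.tendsto_cofinite_zero
    have hev := ht.eventually (gt_mem_nhds hm0)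
    rw [Filter.eventually_cofinite] at hev
    refine (hev.image Subtype.val).subset ?_
    rintro Q ⟨hQ, hIQ⟩
    exact ⟨⟨Q, hQ⟩, not_lt.2 (hlow Q hQ hIQ), rfl⟩
  have hbd : ∀ H : Finset (ℝ × ℝ), (∀ I ∈ H, I ∈ F ∧ τ I ≠ 0) → ∑ I ∈ H, τ I ≤
      (B * (2 + Real.log (M / δ) / (1 - ε)) + 5 / (1 - ε)) * mass u L := by
    intro H hH
    have hGf : (⋃ I ∈ H, {Q | Q ∈ F ∧ ivSet I ⊆ ivSet Q}).Finite :=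
      Set.Finite.biUnion H.finite_toSet fun I hI => hfin I (hH I hI).1 (hH I hI).2
    set G := hGf.toFinset with hGdef
    have memG : ∀ Q, Q ∈ G ↔ ∃ I ∈ H, Q ∈ F ∧ ivSet I ⊆ ivSet Q := by
      intro Q
      rw [hGdef, Set.Finite.mem_toFinset]
      simp only [Set.mem_iUnion, Set.mem_ofPred_eq, exists_prop]
    have hHG : H ⊆ G := fun I hI => (memG I).2 ⟨I, hI, (hH I hI).1, le_rfl⟩
    have hFS : FS ε G := by
      apply FS_of hS
      · intro I hI
        obtain ⟨_, _, h, _⟩ := (memG I).1 hI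
        exact h.1
      · intro I hI R hR Q hQ hIQ hQR
        obtain ⟨I₀, hI₀, hIF, hsub⟩ := (memG I).1 hI
        obtain ⟨_, _, hRF, _⟩ := (memG R).1 hR
        exact (memG Q).2 ⟨I₀, hI₀, ⟨hQ, hQR.subset.trans hRF.2.1, hP I hIF.1 Q hQ hIF.2.2 hIQ⟩,
          hsub.trans hIQ⟩
    rw [← Finset.sum_filter_add_sum_filter_not H (fun I => δ ≤ len I ∧ τ I ≤ B * mass u I)]
    have b1 : ∑ I ∈ H with (δ ≤ len I ∧ τ I ≤ B * mass u I), τ I ≤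
        B * ((2 + Real.log (M / δ) / (1 - ε)) * mass u L) := by
      refine le_trans (Finset.sum_le_sum (g := fun I => B * mass u I)
        fun I hI => (Finset.mem_filter.1 hI).2.2) ?_
      rw [← Finset.mul_sum]
      apply mul_le_mul_of_nonneg_left _ hB
      apply sum_mass_le hε hε1 hFS L u hu hui δ M hδ hM _ ((Finset.filter_subset _ _).trans hHG)
      · intro I hI
        exact (hH I (Finset.mem_filter.1 hI).1).1.2.1
      · intro I hI
        rw [Finset.mem_filter] at hI
        have hIF := (hH I hI.1).1
        exact ⟨hI.2.1, (len_mono (hS.2.1 I hIF.1) hIF.2.1).trans hLM⟩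
    have b2 : ∑ I ∈ H with ¬ (δ ≤ len I ∧ τ I ≤ B * mass u I), τ I ≤
        5 / (1 - ε) * mass u L := by
      refine le_trans (Finset.sum_le_sum
        (g := fun I => c * ((volume.real (ivSet I ∩ Set.Ico α β) / len I) ^ 2 * len I)) ?_) ?_
      · intro I hI
        rw [Finset.mem_filter] at hI
        have hIF := (hH I hI.1)
        rcases hterm I hIF.1.1 hIF.1.2.1 hIF.1.2.2 with h | h | h
        · exact absurd h hIF.2
        · exact absurd h hI.2
        · exact h
      · rw [← Finset.mul_sum]
        have := hFS.carl hε hε1 α β (H.filter fun I => ¬ (δ ≤ len I ∧ τ I ≤ B * mass u I))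
          ((Finset.filter_subset _ _).trans hHG)
        calc _ ≤ c * (5 * volume.real (Set.Ico α β) / (1 - ε)) := by gcongr
          _ = 5 / (1 - ε) * (c * volume.real (Set.Ico α β)) := by ring
          _ ≤ _ := by gcongr
    calc _ ≤ _ := add_le_add b1 b2
      _ = _ := by ring
  apply hsum.tsum_le_of_sum_le
  intro s
  have e : ∑ I ∈ s, τ I = ∑ I ∈ (s.map (Function.Embedding.subtype _)).filter (fun I => τ I ≠ 0), τ I := by
    rw [Finset.sum_filter_ne_zero, Finset.sum_map]
    rfl
  rw [e]
  apply hbd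
  intro I hI
  rw [Finset.mem_filter] at hI
  obtain ⟨I', _, rfl⟩ := Finset.mem_map.1 hI.1
  exact ⟨I'.2, hI.2⟩

/-- the number of children, as a real -/
def NN (k : ℕ) : ℝ := (3 : ℝ) ^ (k - 1)

/-- the ratio `3^k/(3^{k-1}+1)` -/
def aa (k : ℕ) : ℝ := (3 : ℝ) ^ k / ((3 : ℝ) ^ (k - 1) + 1)

/-- side length of the children -/
def hh (k : ℕ) (K : ℝ × ℝ) : ℝ := (3 : ℝ) ^ (1 - (k : ℤ)) * len (mid K)

/-- the children -/
def chd (k : ℕ) (K : ℝ × ℝ) (j : ℕ) : ℝ × ℝ :=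
  ((mid K).1 + (j : ℝ) * ((3 : ℝ) ^ (1 - (k : ℤ)) * len (mid K)),
             (mid K).1 + ((j : ℝ) + 1) * ((3 : ℝ) ^ (1 - (k : ℤ)) * len (mid K)))

lemma NN_ge {k : ℕ} (hk : 3000 < k) : 27 ≤ NN k := by
  unfold NN
  calc (27 : ℝ) = 3 ^ 3 := by norm_num
    _ ≤ 3 ^ (k - 1) := by
      apply pow_le_pow_right₀ (by norm_num)
      omega

lemma three_pow {k : ℕ} (hk : 3000 < k) : (3 : ℝ) ^ k = 3 * NN k := by
  unfold NN
  rw [← pow_succ']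
  congr 1
  omega

lemma zp1 {k : ℕ} (hk : 3000 < k) : (3 : ℝ) ^ (1 - (k : ℤ)) = 1 / NN k := by
  rw [zpow_sub₀ (by norm_num), zpow_natCast, three_pow hk, zpow_one]
  have := NN_ge hk
  field_simp

lemma zp2 {k : ℕ} (hk : 3000 < k) : (3 : ℝ) ^ (-(k : ℤ)) = 1 / (3 * NN k) := by
  rw [zpow_neg, zpow_natCast, three_pow hk, one_div]

lemma aa_eq {k : ℕ} (hk : 3000 < k) : aa k = 3 * NN k / (NN k + 1) := by
  unfold aa
  rw [three_pow hk]
  rfl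

lemma aa_mul {k : ℕ} (hk : 3000 < k) : aa k * (NN k + 1) = 3 * NN k := by
  have := NN_ge hk
  rw [aa_eq hk]
  field_simp

lemma aa_gt {k : ℕ} (hk : 3000 < k) : 1 < aa k := by
  have := NN_ge hk
  have := aa_mul hk
  by_contra h
  nlinarith

lemma len_mid (K : ℝ × ℝ) : len (mid K) = len K / 3 := by
  simp only [len, mid]; ring

lemma hh_eq {k : ℕ} (hk : 3000 < k) (K : ℝ × ℝ) : hh k K = len K / (3 * NN k) := by
  have := NN_ge hk
  unfold hh
  rw [zp1 hk, len_mid]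
  field_simp

lemma N_hh {k : ℕ} (hk : 3000 < k) (K : ℝ × ℝ) : NN k * hh k K = len K / 3 := by
  have := NN_ge hk
  rw [hh_eq hk]
  field_simp

lemma len_chd (k : ℕ) (K : ℝ × ℝ) (j : ℕ) : len (chd k K j) = hh k K := by
  simp only [len, chd, hh]; ring

lemma Kfam_succ {k i : ℕ} {K' : ℝ × ℝ} :
    K' ∈ Kfam k (i + 1) ↔ ∃ K ∈ Kfam k i, ∃ j : ℕ, j < 3 ^ (k - 1) ∧ K' = chd k K j := Iff.rfl

lemma hh_pos {k : ℕ} {K : ℝ × ℝ} (h : K.1 < K.2) : 0 < hh k K := by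
  unfold hh
  rw [len_mid]
  have : 0 < len K := sub_pos.2 h
  positivity

lemma K_pos {k i : ℕ} {K : ℝ × ℝ} (hK : K ∈ Kfam k i) : K.1 < K.2 := by
  induction i generalizing K with
  | zero =>
    have : K = (0, 1) := hK
    subst this
    norm_num
  | succ i ih =>
    obtain ⟨K₀, hK₀, j, hj, rfl⟩ := Kfam_succ.1 hK
    rw [← sub_pos]
    change 0 < len _
    rw [len_chd]
    exact hh_pos (ih hK₀)

lemma mem_chd {k : ℕ} {K : ℝ × ℝ} {j : ℕ} {x : ℝ} : x ∈ ivSet (chd k K j) ↔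
    (K.1 + len K / 3 + j * hh k K ≤ x ∧ x < K.1 + len K / 3 + (j + 1) * hh k K) := Iff.rfl

lemma mem_mid {K : ℝ × ℝ} {x : ℝ} : x ∈ ivSet (mid K) ↔
    (K.1 + len K / 3 ≤ x ∧ x < K.2 - len K / 3) := Iff.rfl

lemma chd_sub {k : ℕ} (hk : 3000 < k) {K : ℝ × ℝ} (hK : K.1 < K.2) {j : ℕ} (hj : j < 3 ^ (k - 1)) :
    ivSet (chd k K j) ⊆ ivSet (mid K) := by
  intro x hx
  rw [mem_chd] at hx
  rw [mem_mid]
  have hp := hh_pos (k := k) hK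
  have hN := N_hh hk K
  have hj' : (j : ℝ) + 1 ≤ NN k := by unfold NN; exact_mod_cast hj
  have hl : len K = K.2 - K.1 := rfl
  constructor
  · have : 0 ≤ (j : ℝ) * hh k K := by positivity
    linarith
  · have : ((j : ℝ) + 1) * hh k K ≤ NN k * hh k K := by gcongr
    linarith

lemma mid_sub {K : ℝ × ℝ} (hK : K.1 < K.2) : ivSet (mid K) ⊆ ivSet K := by
  intro x hx
  rw [mem_mid] at hx
  have hl : len K = K.2 - K.1 := rfl
  exact ⟨by linarith, by linarith⟩

lemma mid_cover {k : ℕ} (hk : 3000 < k) {K : ℝ × ℝ} (hK : K.1 < K.2) {x : ℝ}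
    (hx : x ∈ ivSet (mid K)) : ∃ j < 3 ^ (k - 1), x ∈ ivSet (chd k K j) := by
  rw [mem_mid] at hx
  have hp := hh_pos (k := k) hK
  have hN := N_hh hk K
  have hl : len K = K.2 - K.1 := rfl
  have h0 : 0 ≤ (x - (K.1 + len K / 3)) / hh k K := div_nonneg (by linarith) hp.le
  have f1 := Nat.floor_le h0
  have f2 := Nat.lt_floor_add_one ((x - (K.1 + len K / 3)) / hh k K)
  rw [le_div_iff₀ hp] at f1
  rw [div_lt_iff₀ hp] at f2
  refine ⟨⌊(x - (K.1 + len K / 3)) / hh k K⌋₊, ?_, ?_⟩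
  · rw [Nat.floor_lt h0, div_lt_iff₀ hp]
    push_cast
    have : NN k = 3 ^ (k - 1) := rfl
    rw [← this]
    linarith
  · rw [mem_chd]
    constructor <;> linarith

lemma chd_disj {k : ℕ} {K : ℝ × ℝ} (hK : K.1 < K.2) {x : ℝ} {j j' : ℕ}
    (h : x ∈ ivSet (chd k K j)) (h' : x ∈ ivSet (chd k K j')) : j = j' := by
  rw [mem_chd] at h h'
  have hp := hh_pos (k := k) hK
  have a1 : (j : ℝ) < j' + 1 := by
    by_contra hc
    push Not at hc
    have := mul_le_mul_of_nonneg_right hc hp.le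
    linarith
  have a2 : (j' : ℝ) < j + 1 := by
    by_contra hc
    push Not at hc
    have := mul_le_mul_of_nonneg_right hc hp.le
    linarith
  have b1 : j < j' + 1 := by exact_mod_cast a1
  have b2 : j' < j + 1 := by exact_mod_cast a2
  omega

lemma K_disj {k : ℕ} (hk : 3000 < k) {i : ℕ} {K K' : ℝ × ℝ} (hK : K ∈ Kfam k i)
    (hK' : K' ∈ Kfam k i) {x : ℝ} (h : x ∈ ivSet K) (h' : x ∈ ivSet K') : K = K' := by
  induction i generalizing K K' with
  | zero =>
    have e : K = (0, 1) := hK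
    have e' : K' = (0, 1) := hK'
    rw [e, e']
  | succ i ih =>
    obtain ⟨A, hA, j, hj, rfl⟩ := Kfam_succ.1 hK
    obtain ⟨A', hA', j', hj', rfl⟩ := Kfam_succ.1 hK'
    have hAA : A = A' := ih hA hA' (mid_sub (K_pos hA) (chd_sub hk (K_pos hA) hj h))
      (mid_sub (K_pos hA') (chd_sub hk (K_pos hA') hj' h'))
    subst hAA
    rw [chd_disj (K_pos hA) h h']

lemma K_countable (k i : ℕ) : (Kfam k i).Countable := by
  induction i with
  | zero => exact Set.countable_singleton _
  | succ i ih =>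
    have : Kfam k (i + 1) ⊆ ⋃ K ∈ Kfam k i, Set.range (chd k K) := by
      intro K' hK'
      obtain ⟨A, hA, j, hj, rfl⟩ := Kfam_succ.1 hK'
      simp only [Set.mem_iUnion]
      exact ⟨A, hA, j, rfl⟩
    exact (ih.biUnion fun K _ => Set.countable_range _).mono this

lemma IJ_pos {k : ℕ} {ch : ℝ × ℝ → Bool} {K : ℝ × ℝ} {x : ℝ}
    (hx : x ∈ ivSet (IJ k ch (mid K))) :
    (K.1 + len K / 3 - hh k K ≤ x ∧ x < K.1 + len K / 3) ∨
    (K.2 - len K / 3 ≤ x ∧ x < K.2 - len K / 3 + hh k K) := by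
  unfold IJ at hx
  split_ifs at hx
  · right
    exact hx
  · left
    exact hx

lemma IJ_len (k : ℕ) (ch : ℝ × ℝ → Bool) (K : ℝ × ℝ) : len (IJ k ch (mid K)) = hh k K := by
  unfold IJ
  split_ifs <;> simp only [len, hh] <;> ring

lemma hh_le {k : ℕ} (hk : 3000 < k) {K : ℝ × ℝ} (hK : K.1 < K.2) : hh k K ≤ len K / 81 := by
  have := N_hh hk K
  have := NN_ge hk
  have := hh_pos (k := k) hK
  nlinarith

lemma IJ_sub {k : ℕ} (hk : 3000 < k) {ch : ℝ × ℝ → Bool} {K : ℝ × ℝ} (hK : K.1 < K.2) :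
    ivSet (IJ k ch (mid K)) ⊆ ivSet K := by
  intro x hx
  have h1 := hh_le hk hK
  have h2 := hh_pos (k := k) hK
  have hl : len K = K.2 - K.1 := rfl
  rcases IJ_pos hx with h | h <;> exact ⟨by linarith, by linarith⟩

lemma IJ_not_mid {k : ℕ} {ch : ℝ × ℝ → Bool} {K : ℝ × ℝ} (_hK : K.1 < K.2) {x : ℝ}
    (hx : x ∈ ivSet (IJ k ch (mid K))) : x ∉ ivSet (mid K) := by
  rw [mem_mid]
  have hl : len K = K.2 - K.1 := rfl
  rcases IJ_pos hx with h | h <;> rintro ⟨h1, h2⟩ <;> linarith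

/-- union of the level `i` intervals -/
def UU (k i : ℕ) : Set ℝ := {x | ∃ K ∈ Kfam k i, x ∈ ivSet K}

/-- union of the level `i` special intervals -/
def GG (k : ℕ) (ch : ℝ × ℝ → Bool) (i : ℕ) : Set ℝ :=
  {x | ∃ K ∈ Kfam k i, x ∈ ivSet (IJ k ch (mid K))}

lemma UU_anti {k : ℕ} (hk : 3000 < k) : Antitone (UU k) := by
  apply antitone_nat_of_succ_le
  rintro i x ⟨K', hK', hx⟩
  obtain ⟨A, hA, j, hj, rfl⟩ := Kfam_succ.1 hK'
  exact ⟨A, hA, mid_sub (K_pos hA) (chd_sub hk (K_pos hA) hj hx)⟩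

lemma mid_of_UU {k : ℕ} (hk : 3000 < k) {i : ℕ} {K : ℝ × ℝ} (hK : K ∈ Kfam k i) {x : ℝ}
    (hx : x ∈ ivSet K) (hu : x ∈ UU k (i + 1)) : x ∈ ivSet (mid K) := by
  obtain ⟨K', hK', hx'⟩ := hu
  obtain ⟨A, hA, j, hj, rfl⟩ := Kfam_succ.1 hK'
  have h1 := chd_sub hk (K_pos hA) hj hx'
  have := K_disj hk hK hA hx (mid_sub (K_pos hA) h1)
  rw [this]
  exact h1

lemma GG_sub_UU {k : ℕ} (hk : 3000 < k) {ch : ℝ × ℝ → Bool} {i : ℕ} : GG k ch i ⊆ UU k i := by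
  rintro x ⟨K, hK, hx⟩
  exact ⟨K, hK, IJ_sub hk (K_pos hK) hx⟩

lemma GG_not_UU {k : ℕ} (hk : 3000 < k) {ch : ℝ × ℝ → Bool} {i j : ℕ} (hij : i < j) {x : ℝ}
    (hx : x ∈ GG k ch i) : x ∉ UU k j := by
  intro h
  have h' : x ∈ UU k (i + 1) := UU_anti hk hij h
  obtain ⟨K, hK, hx⟩ := hx
  exact IJ_not_mid (K_pos hK) hx (mid_of_UU hk hK (IJ_sub hk (K_pos hK) hx) h')

lemma GG_unique {k : ℕ} (hk : 3000 < k) {ch : ℝ × ℝ → Bool} {i j : ℕ} {x : ℝ}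
    (hx : x ∈ GG k ch i) (hx' : x ∈ GG k ch j) : i = j := by
  rcases lt_trichotomy i j with h | h | h
  · exact absurd (GG_sub_UU hk hx') (GG_not_UU hk h hx)
  · exact h
  · exact absurd (GG_sub_UU hk hx) (GG_not_UU hk h hx')

lemma GG_meas (k : ℕ) (ch : ℝ × ℝ → Bool) (i : ℕ) : MeasurableSet (GG k ch i) := by
  have : GG k ch i = ⋃ K ∈ Kfam k i, ivSet (IJ k ch (mid K)) := by
    ext x
    simp [GG]
  rw [this]
  exact MeasurableSet.biUnion (K_countable k i) fun K _ => iv_meas _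

lemma inner_tsum {k : ℕ} (hk : 3000 < k) (ch : ℝ × ℝ → Bool) (i : ℕ) (x : ℝ) :
    (∑' J : ↥(Jfam k (i + 1)), Set.indicator (ivSet (IJ k ch (J : ℝ × ℝ)))
      (fun _ => ((3 : ℝ) ^ k / ((3 : ℝ) ^ (k - 1) + 1)) ^ (i + 1)) x) =
    (GG k ch i).indicator (fun _ => aa k ^ (i + 1)) x := by
  by_cases hx : x ∈ GG k ch i
  · rw [Set.indicator_of_mem hx]
    obtain ⟨K, hK, hxK⟩ := hx
    rw [tsum_eq_single (⟨mid K, K, hK, rfl⟩ : ↥(Jfam k (i + 1)))]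
    · rw [Set.indicator_of_mem hxK]
      rfl
    · rintro ⟨J, K', hK', rfl⟩ hne
      apply Set.indicator_of_notMem
      intro hx'
      apply hne
      have := K_disj hk hK hK' (IJ_sub hk (K_pos hK) hxK) (IJ_sub hk (K_pos hK') hx')
      subst this
      rfl
  · rw [Set.indicator_of_notMem hx]
    convert tsum_zero with J
    obtain ⟨J, K', hK', rfl⟩ := J
    apply Set.indicator_of_notMem
    intro hx'
    exact hx ⟨K', hK', hx'⟩

lemma wgt_eq {k : ℕ} (hk : 3000 < k) (ch : ℝ × ℝ → Bool) (x : ℝ) :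
    wgt k ch x = ∑' i, (GG k ch i).indicator (fun _ => aa k ^ (i + 1)) x := by
  unfold wgt
  congr 1
  ext i
  exact inner_tsum hk ch i x

lemma wgt_of_GG {k : ℕ} (hk : 3000 < k) {ch : ℝ × ℝ → Bool} {x : ℝ} {i : ℕ} (h : x ∈ GG k ch i) :
    wgt k ch x = aa k ^ (i + 1) := by
  rw [wgt_eq hk, tsum_eq_single i]
  · rw [Set.indicator_of_mem h]
  · intro j hj
    apply Set.indicator_of_notMem
    intro h'
    exact hj (GG_unique hk h' h)

lemma wgt_of_not {k : ℕ} (hk : 3000 < k) {ch : ℝ × ℝ → Bool} {x : ℝ} (h : ∀ i, x ∉ GG k ch i) :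
    wgt k ch x = 0 := by
  rw [wgt_eq hk]
  convert tsum_zero with i
  exact Set.indicator_of_notMem (h i) _

lemma ofReal_wgt {k : ℕ} (hk : 3000 < k) (ch : ℝ × ℝ → Bool) (x : ℝ) :
    ENNReal.ofReal (wgt k ch x) =
      ∑' i, (GG k ch i).indicator (fun _ => ENNReal.ofReal (aa k ^ (i + 1))) x := by
  by_cases h : ∃ i, x ∈ GG k ch i
  · obtain ⟨i, h⟩ := h
    rw [wgt_of_GG hk h, tsum_eq_single i]
    · rw [Set.indicator_of_mem h]
    · intro j hj
      apply Set.indicator_of_notMem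
      intro h'
      exact hj (GG_unique hk h' h)
  · push Not at h
    rw [wgt_of_not hk h, ENNReal.ofReal_zero]
    symm
    rw [ENNReal.tsum_eq_zero]
    exact fun i => Set.indicator_of_notMem (h i) _

lemma wgt_nonneg {k : ℕ} (hk : 3000 < k) (ch : ℝ × ℝ → Bool) (x : ℝ) : 0 ≤ wgt k ch x := by
  have := aa_gt hk
  by_cases h : ∃ i, x ∈ GG k ch i
  · obtain ⟨i, h⟩ := h
    rw [wgt_of_GG hk h]
    positivity
  · push Not at h
    rw [wgt_of_not hk h]

lemma wgt_meas {k : ℕ} (hk : 3000 < k) (ch : ℝ × ℝ → Bool) : Measurable (wgt k ch) := by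
  have : wgt k ch = fun x =>
      (∑' i, (GG k ch i).indicator (fun _ => ENNReal.ofReal (aa k ^ (i + 1))) x).toReal := by
    ext x
    rw [← ofReal_wgt hk, ENNReal.toReal_ofReal (wgt_nonneg hk ch x)]
  rw [this]
  apply Measurable.ennreal_toReal
  apply Measurable.tsum
  intro i
  exact measurable_const.indicator (GG_meas k ch i)

lemma wgt_IJ {k : ℕ} (hk : 3000 < k) {ch : ℝ × ℝ → Bool} {i : ℕ} {K : ℝ × ℝ} (hK : K ∈ Kfam k i)
    {x : ℝ} (hx : x ∈ ivSet (IJ k ch (mid K))) : wgt k ch x = aa k ^ (i + 1) :=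
  wgt_of_GG hk ⟨K, hK, hx⟩

lemma wgt_rest {k : ℕ} (hk : 3000 < k) {ch : ℝ × ℝ → Bool} {i : ℕ} {K : ℝ × ℝ} (hK : K ∈ Kfam k i)
    {x : ℝ} (hx : x ∈ ivSet K) (h1 : x ∉ ivSet (mid K)) (h2 : x ∉ ivSet (IJ k ch (mid K))) :
    wgt k ch x = 0 := by
  apply wgt_of_not hk
  intro j hj
  rcases lt_trichotomy j i with h | h | h
  · exact GG_not_UU hk h hj ⟨K, hK, hx⟩
  · subst h
    obtain ⟨K', hK', hx'⟩ := hj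
    have := K_disj hk hK hK' hx (IJ_sub hk (K_pos hK') hx')
    subst this
    exact h2 hx'
  · exact h1 (mid_of_UU hk hK hx (UU_anti hk h (GG_sub_UU hk hj)))

lemma wgt_ge {k : ℕ} (hk : 3000 < k) {ch : ℝ × ℝ → Bool} {i : ℕ} {K : ℝ × ℝ} (hK : K ∈ Kfam k i)
    {x : ℝ} (hx : x ∈ ivSet K) (h0 : 0 < wgt k ch x) : aa k ^ (i + 1) ≤ wgt k ch x := by
  by_cases h : ∃ j, x ∈ GG k ch j
  · obtain ⟨j, h⟩ := h
    rw [wgt_of_GG hk h]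
    apply pow_le_pow_right₀ (aa_gt hk).le
    by_contra hc
    exact GG_not_UU hk (show j < i by omega) h ⟨K, hK, hx⟩
  · push Not at h
    rw [wgt_of_not hk h] at h0
    exact absurd h0 (lt_irrefl _)

lemma lint_split {k : ℕ} (hk : 3000 < k) {ch : ℝ × ℝ → Bool} {i : ℕ} {K : ℝ × ℝ}
    (hK : K ∈ Kfam k i) (f : ℝ → ENNReal) (hfm : Measurable f)
    (hf : ∀ x, f x ≤ ENNReal.ofReal (wgt k ch x)) (I : ℝ × ℝ) (hI : ivSet I ⊆ ivSet K)
    (T : Finset ℕ) (hT : ∀ j < 3 ^ (k - 1), (ivSet (chd k K j) ∩ ivSet I).Nonempty → j ∈ T) :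
    ∫⁻ x in ivSet I, f x ≤ ENNReal.ofReal (aa k ^ (i + 1)) *
      volume (ivSet (IJ k ch (mid K)) ∩ ivSet I) +
      ∑ j ∈ T, ∫⁻ x in ivSet (chd k K j), f x := by
  have hpt : ∀ x ∈ ivSet I, f x ≤
      (ivSet (IJ k ch (mid K))).indicator (fun _ => ENNReal.ofReal (aa k ^ (i + 1))) x +
      ∑ j ∈ T, (ivSet (chd k K j)).indicator f x := by
    intro x hx
    by_cases h1 : x ∈ ivSet (IJ k ch (mid K))
    · rw [Set.indicator_of_mem h1]
      refine le_trans (hf x) ?_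
      rw [wgt_IJ hk hK h1]
      exact le_self_add
    by_cases h2 : x ∈ ivSet (mid K)
    · obtain ⟨j, hj, hxj⟩ := mid_cover hk (K_pos hK) h2
      have hjT := hT j hj ⟨x, hxj, hx⟩
      refine le_trans ?_ le_add_self
      refine le_trans ?_ (Finset.single_le_sum (f := fun j => (ivSet (chd k K j)).indicator f x)
        (fun _ _ => zero_le) hjT)
      rw [Set.indicator_of_mem hxj]
    · refine le_trans (hf x) ?_
      rw [wgt_rest hk hK (hI hx) h2 h1]
      simp
  refine le_trans (setLIntegral_mono' (iv_meas I) hpt) ?_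
  rw [lintegral_add_left (measurable_const.indicator (iv_meas _)), lintegral_finsetSum]
  · apply add_le_add
    · rw [lintegral_indicator (iv_meas _), setLIntegral_const, Measure.restrict_apply (iv_meas _)]
    · apply Finset.sum_le_sum
      intro j _
      rw [lintegral_indicator (iv_meas _)]
      exact lintegral_mono' (Measure.restrict_mono_measure Measure.restrict_le_self _) le_rfl
  · intro j _
    exact hfm.indicator (iv_meas _)

/-- truncated weight -/
def VV (k : ℕ) (ch : ℝ × ℝ → Bool) (n : ℕ) (x : ℝ) : ENNReal :=
  ∑ j ∈ Finset.range n, (GG k ch j).indicator (fun _ => ENNReal.ofReal (aa k ^ (j + 1))) x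

lemma VV_meas (k : ℕ) (ch : ℝ × ℝ → Bool) (n : ℕ) : Measurable (VV k ch n) := by
  unfold VV
  exact Finset.measurable_fun_sum _ fun j _ => measurable_const.indicator (GG_meas k ch j)

lemma VV_le {k : ℕ} (hk : 3000 < k) (ch : ℝ × ℝ → Bool) (n : ℕ) (x : ℝ) :
    VV k ch n x ≤ ENNReal.ofReal (wgt k ch x) := by
  rw [ofReal_wgt hk]
  exact ENNReal.sum_le_tsum _

lemma vol_iv' (I : ℝ × ℝ) : volume (ivSet I) = ENNReal.ofReal (len I) := by
  simp [ivSet, len, Real.volume_Ico]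

lemma VV_bound {k : ℕ} (hk : 3000 < k) (ch : ℝ × ℝ → Bool) (m : ℕ) : ∀ (i : ℕ) (K : ℝ × ℝ),
    K ∈ Kfam k i → ∫⁻ x in ivSet K, VV k ch (i + m) x ≤ ENNReal.ofReal (aa k ^ i * len K) := by
  induction m with
  | zero =>
    intro i K hK
    have : ∫⁻ x in ivSet K, VV k ch (i + 0) x = ∫⁻ x in ivSet K, 0 := by
      apply setLIntegral_congr_fun (iv_meas K)
      intro x hx
      simp only [VV]
      apply Finset.sum_eq_zero
      intro j hj
      apply Set.indicator_of_notMem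
      intro h
      rw [Finset.mem_range] at hj
      exact GG_not_UU hk (show j < i by omega) h ⟨K, hK, hx⟩
    rw [this]
    simp
  | succ m ih =>
    intro i K hK
    have ha := aa_gt hk
    have hp := hh_pos (k := k) (K_pos hK)
    have h := lint_split hk (ch := ch) hK (VV k ch (i + (m + 1))) (VV_meas _ _ _) (VV_le hk ch _)
      K le_rfl (Finset.range (3 ^ (k - 1))) (fun j hj _ => Finset.mem_range.2 hj)
    refine le_trans h ?_
    have h1 : volume (ivSet (IJ k ch (mid K)) ∩ ivSet K) ≤ ENNReal.ofReal (hh k K) := by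
      rw [← IJ_len k ch, ← vol_iv']
      exact measure_mono Set.inter_subset_left
    have h2 : ∀ j ∈ Finset.range (3 ^ (k - 1)),
        ∫⁻ x in ivSet (chd k K j), VV k ch (i + (m + 1)) x ≤
        ENNReal.ofReal (aa k ^ (i + 1) * hh k K) := by
      intro j hj
      have := ih (i + 1) (chd k K j) (Kfam_succ.2 ⟨K, hK, j, Finset.mem_range.1 hj, rfl⟩)
      rw [len_chd] at this
      rwa [show i + (m + 1) = i + 1 + m by ring]
    calc _ ≤ ENNReal.ofReal (aa k ^ (i + 1)) * ENNReal.ofReal (hh k K) +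
          ∑ j ∈ Finset.range (3 ^ (k - 1)), ENNReal.ofReal (aa k ^ (i + 1) * hh k K) := by
          gcongr with j hj
          exact h2 j hj
      _ = ENNReal.ofReal (aa k ^ (i + 1) * hh k K +
          ∑ j ∈ Finset.range (3 ^ (k - 1)), aa k ^ (i + 1) * hh k K) := by
          rw [ENNReal.ofReal_add (by positivity) (by positivity),
            ENNReal.ofReal_sum_of_nonneg (fun _ _ => by positivity),
            ENNReal.ofReal_mul (by positivity)]
      _ = _ := by
          congr 1
          rw [Finset.sum_const, Finset.card_range, nsmul_eq_mul]
          push_cast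
          change aa k ^ (i + 1) * hh k K + NN k * (aa k ^ (i + 1) * hh k K) = _
          have e1 := aa_mul hk
          have e2 := N_hh hk K
          calc _ = aa k ^ i * (aa k * (NN k + 1)) * hh k K := by ring
            _ = aa k ^ i * (3 * (NN k * hh k K)) := by rw [e1]; ring
            _ = _ := by rw [e2]; ring

lemma lint_K {k : ℕ} (hk : 3000 < k) (ch : ℝ × ℝ → Bool) {i : ℕ} {K : ℝ × ℝ}
    (hK : K ∈ Kfam k i) :
    ∫⁻ x in ivSet K, ENNReal.ofReal (wgt k ch x) ≤ ENNReal.ofReal (aa k ^ i * len K) := by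
  simp_rw [ofReal_wgt hk]
  rw [lintegral_tsum (fun j => (measurable_const.indicator (GG_meas k ch j)).aemeasurable)]
  apply ENNReal.tsum_le_of_sum_range_le
  intro n
  rw [← lintegral_finsetSum _ (fun j _ => measurable_const.indicator (GG_meas k ch j))]
  refine le_trans ?_ (VV_bound hk ch n i K hK)
  apply lintegral_mono
  intro x
  unfold VV
  exact Finset.sum_le_sum_of_subset (Finset.range_mono (by omega))

lemma wgt_int {k : ℕ} (hk : 3000 < k) (ch : ℝ × ℝ → Bool) {i : ℕ} {K : ℝ × ℝ}
    (hK : K ∈ Kfam k i) : IntegrableOn (wgt k ch) (ivSet K) := by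
  refine ⟨(wgt_meas hk ch).aestronglyMeasurable, ?_⟩
  rw [hasFiniteIntegral_iff_ofReal (ae_of_all _ (wgt_nonneg hk ch))]
  exact lt_of_le_of_lt (lint_K hk ch hK) ENNReal.ofReal_lt_top

lemma mass_wgt_le {k : ℕ} (hk : 3000 < k) (ch : ℝ × ℝ → Bool) {i : ℕ} {K : ℝ × ℝ}
    (hK : K ∈ Kfam k i) (I : ℝ × ℝ) (hIp : I.1 < I.2) (hI : ivSet I ⊆ ivSet K)
    (hl : hh k K ≤ 4 * len I) : mass (wgt k ch) I ≤ 10 * aa k ^ (i + 1) * len I := by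
  classical
  have ha := aa_gt hk
  have hp := hh_pos (k := k) (K_pos hK)
  have hlI : 0 < len I := sub_pos.2 hIp
  unfold mass
  rw [integral_eq_lintegral_of_nonneg_ae (ae_of_all _ (wgt_nonneg hk ch))
    (wgt_meas hk ch).aestronglyMeasurable]
  apply ENNReal.toReal_le_of_le_ofReal (by positivity)
  set T := (Finset.range (3 ^ (k - 1))).filter fun j => (ivSet (chd k K j) ∩ ivSet I).Nonempty
    with hT
  have h := lint_split hk (ch := ch) hK (fun x => ENNReal.ofReal (wgt k ch x))
    (wgt_meas hk ch).ennreal_ofReal (fun _ => le_rfl) I hI T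
    (fun j hj hne => Finset.mem_filter.2 ⟨Finset.mem_range.2 hj, hne⟩)
  refine le_trans h ?_
  have h1 : volume (ivSet (IJ k ch (mid K)) ∩ ivSet I) ≤ ENNReal.ofReal (len I) := by
    rw [← vol_iv']
    exact measure_mono Set.inter_subset_right
  have h2 : ∀ j ∈ T, ∫⁻ x in ivSet (chd k K j), ENNReal.ofReal (wgt k ch x) ≤
      ENNReal.ofReal (aa k ^ (i + 1) * hh k K) := by
    intro j hj
    have := lint_K hk ch (i := i + 1) (K := chd k K j) (Kfam_succ.2 ⟨K, hK, j,
      Finset.mem_range.1 (Finset.mem_filter.1 hj).1, rfl⟩)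
    rwa [len_chd] at this
  have hcard : (T.card : ℝ) * hh k K ≤ len I + 2 * hh k K := by
    have hd : Set.PairwiseDisjoint (↑T) (fun j => ivSet (chd k K j)) := by
      intro j _ j' _ hne
      rw [Function.onFun, Set.disjoint_left]
      intro x hx hx'
      exact hne (chd_disj (K_pos hK) hx hx')
    have e : volume.real (⋃ j ∈ T, ivSet (chd k K j)) = T.card * hh k K := by
      rw [measureReal_biUnion_finset hd (fun j _ => iv_meas _) (fun j _ => iv_fin _)]
      have : ∀ j ∈ T, volume.real (ivSet (chd k K j)) = hh k K := by
        intro j _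
        rw [vol_iv, len_chd]
        rw [← sub_nonneg]
        change 0 ≤ len _
        rw [len_chd]
        exact hp.le
      rw [Finset.sum_congr rfl this, Finset.sum_const, nsmul_eq_mul]
    rw [← e]
    have e2 : len I + 2 * hh k K = volume.real (ivSet (I.1 - hh k K, I.2 + hh k K)) := by
      rw [vol_iv]
      · simp only [len]; ring
      · simp only; linarith
    rw [e2]
    apply measureReal_mono _ (iv_fin _)
    refine Set.iUnion₂_subset ?_
    intro j hj x hx
    obtain ⟨y, hy, hyI⟩ := (Finset.mem_filter.1 hj).2
    rw [mem_chd] at hx hy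
    have h3 : I.1 ≤ y := hyI.1
    have h4 : y < I.2 := hyI.2
    exact ⟨by simp only; linarith, by simp only; linarith⟩
  calc _ ≤ ENNReal.ofReal (aa k ^ (i + 1)) * ENNReal.ofReal (len I) +
          ∑ j ∈ T, ENNReal.ofReal (aa k ^ (i + 1) * hh k K) := by
          gcongr with j hj
          exact h2 j hj
      _ = ENNReal.ofReal (aa k ^ (i + 1) * len I +
          ∑ j ∈ T, aa k ^ (i + 1) * hh k K) := by
          rw [ENNReal.ofReal_add (by positivity) (by positivity),
            ENNReal.ofReal_sum_of_nonneg (fun _ _ => by positivity),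
            ENNReal.ofReal_mul (p := aa k ^ (i + 1)) (q := len I) (by positivity)]
      _ ≤ _ := by
          apply ENNReal.ofReal_le_ofReal
          rw [Finset.sum_const, nsmul_eq_mul]
          have : len I + T.card * hh k K ≤ 10 * len I := by linarith
          have ha' : 0 ≤ aa k ^ (i + 1) := by positivity
          nlinarith

lemma sgm_nonneg {p : ℝ} {k : ℕ} (hk : 3000 < k) (ch : ℝ × ℝ → Bool) (x : ℝ) :
    0 ≤ sgm p k ch x := by
  unfold sgm
  split_ifs
  · exact Real.rpow_nonneg (wgt_nonneg hk ch x) _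
  · exact le_rfl

lemma sgm_le {p : ℝ} (hp : 1 < p) {k : ℕ} (hk : 3000 < k) (ch : ℝ × ℝ → Bool) {i : ℕ} {K : ℝ × ℝ}
    (hK : K ∈ Kfam k i) {x : ℝ} (hx : x ∈ ivSet K) :
    sgm p k ch x ≤ (aa k ^ (i + 1)) ^ (1 - p) := by
  have ha := aa_gt hk
  unfold sgm
  split_ifs with h
  · exact Real.rpow_le_rpow_of_nonpos (by positivity) (wgt_ge hk hK hx h) (by linarith)
  · positivity

lemma sgm_meas (p : ℝ) {k : ℕ} (hk : 3000 < k) (ch : ℝ × ℝ → Bool) : Measurable (sgm p k ch) := by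
  unfold sgm
  refine Measurable.ite ?_ ((wgt_meas hk ch).pow_const _) measurable_const
  exact measurableSet_lt measurable_const (wgt_meas hk ch)

lemma sgm_int {p : ℝ} (hp : 1 < p) {k : ℕ} (hk : 3000 < k) (ch : ℝ × ℝ → Bool) {i : ℕ}
    {K : ℝ × ℝ} (hK : K ∈ Kfam k i) : IntegrableOn (sgm p k ch) (ivSet K) := by
  apply Measure.integrableOn_of_bounded (M := (aa k ^ (i + 1)) ^ (1 - p)) (iv_fin K)
    (sgm_meas p hk ch).aestronglyMeasurable
  filter_upwards [ae_restrict_mem (iv_meas K)] with x hx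
  rw [Real.norm_of_nonneg (sgm_nonneg hk ch x)]
  exact sgm_le hp hk ch hK hx

lemma mass_sgm_le {p : ℝ} (hp : 1 < p) {k : ℕ} (hk : 3000 < k) (ch : ℝ × ℝ → Bool) {i : ℕ}
    {K : ℝ × ℝ} (hK : K ∈ Kfam k i) (I : ℝ × ℝ) (hIp : I.1 < I.2) (hI : ivSet I ⊆ ivSet K) :
    mass (sgm p k ch) I ≤ (aa k ^ (i + 1)) ^ (1 - p) * len I := by
  unfold mass
  calc _ ≤ ∫ x in ivSet I, (aa k ^ (i + 1)) ^ (1 - p) := by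
        apply setIntegral_mono_on ((sgm_int hp hk ch hK).mono_set hI)
          (integrableOn_const (iv_fin I)) (iv_meas I)
        intro x hx
        exact sgm_le hp hk ch hK (hI hx)
    _ = _ := by
        rw [setIntegral_const, vol_iv hIp.le, smul_eq_mul, mul_comm]

lemma wgt_small {k : ℕ} (hk : 3000 < k) (ch : ℝ × ℝ → Bool) {i : ℕ} {K : ℝ × ℝ}
    (hK : K ∈ Kfam k i) (I : ℝ × ℝ) (hI : ivSet I ⊆ ivSet K)
    (hs : len I < (1 / 3 - 1 / (3 * NN k)) * hh k K)
    (hn : ∀ K' ∈ chK k K, ¬ ivSet I ⊆ ivSet K') {x : ℝ} (hx : x ∈ ivSet I)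
    (h1 : x ∉ ivSet (IJ k ch (mid K))) : wgt k ch x = 0 := by
  by_cases h2 : x ∈ ivSet (mid K)
  swap
  · exact wgt_rest hk hK (hI hx) h2 h1
  obtain ⟨j, hj, hxj⟩ := mid_cover hk (K_pos hK) h2
  have hK' : chd k K j ∈ Kfam k (i + 1) := Kfam_succ.2 ⟨K, hK, j, hj, rfl⟩
  have hns := hn (chd k K j) ⟨i, hK, hK', (chd_sub hk (K_pos hK) hj).trans (mid_sub (K_pos hK))⟩
  obtain ⟨y, hyI, hy⟩ := Set.not_subset.1 hns
  set K' := chd k K j with hKdef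
  have hlen : len K' = hh k K := len_chd k K j
  have hlen' : len K' = K'.2 - K'.1 := rfl
  have hh' : hh k K' = 1 / (3 * NN k) * hh k K := by
    rw [hh_eq hk, hlen]; ring
  have hp := hh_pos (k := k) (K_pos hK')
  have hlI : len I = I.2 - I.1 := rfl
  have a1 : I.1 ≤ x := hx.1
  have a2 : x < I.2 := hx.2
  have a3 : I.1 ≤ y := hyI.1
  have a4 : y < I.2 := hyI.2
  have b1 : K'.1 ≤ x := hxj.1
  have b2 : x < K'.2 := hxj.2
  have hy' : y < K'.1 ∨ K'.2 ≤ y := by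
    by_contra hc
    push Not at hc
    exact hy ⟨hc.1, hc.2⟩
  have hs' : len I < len K' / 3 - hh k K' := by
    rw [hh', hlen]; linarith
  apply wgt_rest hk hK' hxj
  · rw [mem_mid]
    rintro ⟨c1, c2⟩
    rcases hy' with h | h <;> linarith
  · intro hc
    rcases IJ_pos hc with ⟨c1, c2⟩ | ⟨c1, c2⟩ <;> rcases hy' with h | h <;> linarith

lemma term_big {x y l m X Y q : ℝ} (hx : 0 ≤ x) (hxX : x ≤ X) (hq : 1 < q) (hy : 0 ≤ y)
    (hyY : y ≤ Y) (hl : 0 < l) (hm : m = x * l) : x ^ q * y * l ≤ X ^ (q - 1) * Y * m := by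
  have e : x ^ q = x ^ (q - 1) * x := by
    rw [← Real.rpow_add_one' hx (by linarith)]
    congr 1
    ring
  have h1 : x ^ (q - 1) ≤ X ^ (q - 1) := Real.rpow_le_rpow hx hxX (by linarith)
  have hX : 0 ≤ X := hx.trans hxX
  rw [e, hm]
  calc x ^ (q - 1) * x * y * l = x ^ (q - 1) * y * (x * l) := by ring
    _ ≤ X ^ (q - 1) * Y * (x * l) := by gcongr

lemma term_small {c d θ l q : ℝ} (hc : 0 ≤ c) (hd : 0 ≤ d) (h0 : 0 ≤ θ) (h1 : θ ≤ 1) (hq : 1 < q)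
    (hl : 0 < l) : (c * θ) ^ q * (d * θ) * l ≤ c ^ q * d * (θ ^ 2 * l) := by
  rw [Real.mul_rpow hc h0]
  have : θ ^ q ≤ θ := by
    rcases h0.eq_or_lt with h | h
    · rw [← h, Real.zero_rpow (by linarith)]
    · calc θ ^ q ≤ θ ^ (1 : ℝ) := Real.rpow_le_rpow_of_exponent_ge h h1 hq.le
        _ = θ := Real.rpow_one θ
  calc c ^ q * θ ^ q * (d * θ) * l = c ^ q * d * l * θ * θ ^ q := by ring
    _ ≤ c ^ q * d * l * θ * θ := by gcongr
    _ = _ := by ring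

lemma log_bd {k : ℕ} (hk : 3000 < k) {K : ℝ × ℝ} (hK : K.1 < K.2) :
    Real.log (len K / ((1 / 3 - 1 / (3 * NN k)) * hh k K)) ≤ 3 * k := by
  have hN := NN_ge hk
  have hp := hh_pos (k := k) hK
  have hlK : 0 < len K := sub_pos.2 hK
  have hq : 1 / (3 * NN k) ≤ 1 / 81 := by
    apply one_div_le_one_div_of_le <;> linarith
  have hNh := N_hh hk K
  have hδ : 0 < (1 / 3 - 1 / (3 * NN k)) * hh k K := by
    apply mul_pos _ hp; linarith
  have h1 : len K / ((1 / 3 - 1 / (3 * NN k)) * hh k K) ≤ 4 * 3 ^ k := by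
    rw [div_le_iff₀ hδ, three_pow hk]
    have : 1 / 4 * hh k K ≤ (1 / 3 - 1 / (3 * NN k)) * hh k K := by
      gcongr; linarith
    calc len K = 4 * (3 * NN k) * (1 / 4 * hh k K) := by linarith
      _ ≤ _ := by gcongr
  have h2 := Real.log_le_log (by positivity) h1
  rw [Real.log_mul (by norm_num) (by positivity), Real.log_pow] at h2
  have h3 := Real.log_le_sub_one_of_pos (show (0 : ℝ) < 3 by norm_num)
  have h4 := Real.log_le_sub_one_of_pos (show (0 : ℝ) < 4 by norm_num)
  have hk' : (3000 : ℝ) < k := by exact_mod_cast hk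
  nlinarith

lemma final_bound {k : ℕ} (hk : 3000 < k) {ε lg B m : ℝ} (hε : 0 < ε) (hε1 : ε < 1)
    (hlg : lg ≤ 3 * k) (hB : 0 ≤ B) (hm : 0 ≤ m) :
    (B * (2 + lg / (1 - ε)) + 5 / (1 - ε)) * m ≤ (5 * B + 5) * k * m / (1 - ε) := by
  have h1 : 0 < 1 - ε := by linarith
  have hk' : (3000 : ℝ) < k := by exact_mod_cast hk
  have e : (5 * B + 5) * k * m / (1 - ε) = (B * (2 * k / (1 - ε) + 3 * k / (1 - ε)) +
    5 * k / (1 - ε)) * m := by ring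
  rw [e]
  have : 2 ≤ 2 * k / (1 - ε) := by
    rw [le_div_iff₀ h1]; nlinarith
  gcongr
  linarith

lemma both {p : ℝ} (hp : 1 < p) {k : ℕ} (hk : 3000 < k) (ch : ℝ × ℝ → Bool) {ε : ℝ} (hε : 0 < ε)
    (hε1 : ε < 1) {S : Set (ℝ × ℝ)} (hS : MSparse ε S) {i : ℕ} {K : ℝ × ℝ} (hK : K ∈ Kfam k i)
    (L : ℝ × ℝ) (hL : L.1 < L.2) (hLK : ivSet L ⊆ ivSet K) (P : ℝ × ℝ → Prop)
    (hP : ∀ I ∈ S, ∀ Q ∈ S, P I → ivSet I ⊆ ivSet Q → P Q)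
    (hPor : ∀ I ∈ S, P I → (1 / 3 - (3 : ℝ) ^ (-(k : ℤ))) * len (IJ k ch (mid K)) ≤ len I ∨
      ∀ K' ∈ chK k K, ¬ ivSet I ⊆ ivSet K') :
    sumTest p (wgt k ch) (sgm p k ch) {I | I ∈ S ∧ ivSet I ⊆ ivSet L ∧ P I} ≤
      (5 * ((10 : ℝ) ^ (p - 1) + 10) + 5) * (k : ℝ) * mass (wgt k ch) L / (1 - ε) ∧
    sumTest (p / (p - 1)) (sgm p k ch) (wgt k ch) {I | I ∈ S ∧ ivSet I ⊆ ivSet L ∧ P I} ≤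
      (5 * ((10 : ℝ) ^ (p - 1) + 10) + 5) * (k : ℝ) * mass (sgm p k ch) L / (1 - ε) := by
  have hKp := K_pos hK
  have hN := NN_ge hk
  have hh0 := hh_pos (k := k) hKp
  have hlK : 0 < len K := sub_pos.2 hKp
  rw [zp2 hk, IJ_len] at hPor
  have hb : 0 < aa k ^ (i + 1) := by have := aa_gt hk; positivity
  have hmw := mass_wgt_le hk ch hK
  have hms := mass_sgm_le hp hk ch hK
  have hq81 : 1 / (3 * NN k) ≤ 1 / 81 := by
    apply one_div_le_one_div_of_le <;> linarith
  have hq0 : 0 < 1 / (3 * NN k) := by positivity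
  have hw0 := wgt_nonneg hk ch
  have hs0 := sgm_nonneg (p := p) hk ch
  have hwi := (wgt_int hk ch hK).mono_set hLK
  have hsi := (sgm_int hp hk ch hK).mono_set hLK
  have hwIJ : ∀ x ∈ ivSet (IJ k ch (mid K)), wgt k ch x = aa k ^ (i + 1) :=
    fun x hx => wgt_IJ hk hK hx
  have hwsm := wgt_small hk ch hK
  have hlog := log_bd hk hKp
  set b : ℝ := aa k ^ (i + 1) with hbdef
  set δ : ℝ := (1 / 3 - 1 / (3 * NN k)) * hh k K with hδdef
  set A : ℝ × ℝ := IJ k ch (mid K) with hA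
  have hδ : 0 < δ := mul_pos (by linarith) hh0
  have hδ4 : hh k K ≤ 4 * δ := by
    have : 1 / 4 * hh k K ≤ (1 / 3 - 1 / (3 * NN k)) * hh k K := by
      gcongr; linarith
    linarith
  have hδM : δ ≤ len K := by
    have h1 := hh_le hk hKp
    have : (1 / 3 - 1 / (3 * NN k)) * hh k K ≤ 1 * hh k K := by gcongr; linarith
    linarith
  have hLM : len L ≤ len K := len_mono hL hLK
  have hsIJ : ∀ x ∈ ivSet A, sgm p k ch x = b ^ (1 - p) := by
    intro x hx
    unfold sgm
    rw [hwIJ x hx, if_pos hb]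
  have hpq : 1 < p / (p - 1) := by rw [lt_div_iff₀ (by linarith)]; linarith
  have h10 : 0 < (10 : ℝ) ^ (p - 1) := by positivity
  have hbs : 0 < b ^ (1 - p) := by positivity
  -- exponents
  have ex1 : (10 * b) ^ (p - 1) * b ^ (1 - p) = 10 ^ (p - 1) := by
    rw [Real.mul_rpow (by norm_num) hb.le, mul_assoc, ← Real.rpow_add hb]
    rw [show p - 1 + (1 - p) = 0 by ring, Real.rpow_zero, mul_one]
  have hpne : p - 1 ≠ 0 := by linarith
  have ex2 : (b ^ (1 - p)) ^ (p / (p - 1) - 1) * (10 * b) = 10 := by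
    rw [← Real.rpow_mul hb.le]
    rw [show (1 - p) * (p / (p - 1) - 1) = -1 by field_simp; ring, Real.rpow_neg_one]
    field_simp
  have ex3 : b ^ p * b ^ (1 - p) = b := by
    rw [← Real.rpow_add hb, show p + (1 - p) = 1 by ring, Real.rpow_one]
  have ex4 : (b ^ (1 - p)) ^ (p / (p - 1)) * b = b ^ (1 - p) := by
    rw [← Real.rpow_mul hb.le]
    nth_rewrite 2 [← Real.rpow_one b]
    rw [← Real.rpow_add hb]
    congr 1
    field_simp
    ring
  -- the interval
  set α := max A.1 L.1 with hα
  set β := min A.2 L.2 with hβ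
  have hαβ : Set.Ico α β = ivSet A ∩ ivSet L := by
    unfold ivSet
    rw [Set.Ico_inter_Ico]
  have hinter : ∀ I : ℝ × ℝ, ivSet I ⊆ ivSet L → ivSet I ∩ Set.Ico α β = ivSet I ∩ ivSet A := by
    intro I hI
    rw [hαβ]
    ext x
    constructor
    · rintro ⟨h1, h2, h3⟩; exact ⟨h1, h2⟩
    · rintro ⟨h1, h2⟩; exact ⟨h1, h2, hI h1⟩
  -- general mass computation
  have hmass : ∀ (u : ℝ → ℝ) (c : ℝ) (I : ℝ × ℝ), (∀ x ∈ ivSet I, x ∈ ivSet A → u x = c) →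
      (∀ x ∈ ivSet I, x ∉ ivSet A → u x = 0) → mass u I = c * volume.real (ivSet I ∩ ivSet A) := by
    intro u c I h1 h2
    unfold mass
    have : ∫ x in ivSet I, u x = ∫ x in ivSet I, (ivSet A).indicator (fun _ => c) x := by
      apply setIntegral_congr_fun (iv_meas I)
      intro x hx
      by_cases hxA : x ∈ ivSet A
      · simp only [Set.indicator_of_mem hxA]; exact h1 x hx hxA
      · simp only [Set.indicator_of_notMem hxA]; exact h2 x hx hxA
    rw [this, setIntegral_indicator (iv_meas A), setIntegral_const, smul_eq_mul, mul_comm]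
  have hcA : ∀ (u : ℝ → ℝ) (c : ℝ), (∀ x, 0 ≤ u x) → IntegrableOn u (ivSet L) →
      (∀ x ∈ ivSet A, u x = c) → c * volume.real (Set.Ico α β) ≤ mass u L := by
    intro u c hu hui h1
    have e : c * volume.real (Set.Ico α β) = ∫ x in Set.Ico α β, u x := by
      rw [setIntegral_congr_fun (g := fun _ => c) measurableSet_Ico, setIntegral_const, smul_eq_mul,
        mul_comm]
      intro x hx
      rw [hαβ] at hx
      exact h1 x hx.1
    rw [e]
    exact setIntegral_mono_set hui (ae_of_all _ hu)
      (show Set.Ico α β ⊆ ivSet L by rw [hαβ]; exact Set.inter_subset_right).eventuallyLE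
  have hposI : ∀ I ∈ S, I.1 < I.2 := hS.2.1
  -- large or small
  have hdich : ∀ I ∈ S, ivSet I ⊆ ivSet L → P I → (δ ≤ len I) ∨
      (mass (wgt k ch) I = b * volume.real (ivSet I ∩ Set.Ico α β) ∧
       mass (sgm p k ch) I = b ^ (1 - p) * volume.real (ivSet I ∩ Set.Ico α β)) := by
    intro I hI hIL hPI
    by_cases hd : δ ≤ len I
    · exact Or.inl hd
    right
    rcases hPor I hI hPI with h | h
    · exact absurd h hd
    push Not at hd
    have hz : ∀ x ∈ ivSet I, x ∉ ivSet A → wgt k ch x = 0 := fun x hx hxA =>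
      hwsm I (hIL.trans hLK) hd h hx hxA
    rw [hinter I hIL]
    refine ⟨hmass _ _ _ (fun x _ hx => hwIJ x hx) hz, hmass _ _ _ (fun x _ hx => hsIJ x hx) ?_⟩
    intro x hx hxA
    unfold sgm
    rw [hz x hx hxA, if_neg (lt_irrefl _)]
  have hθ : ∀ I ∈ S, 0 ≤ volume.real (ivSet I ∩ Set.Ico α β) / len I ∧
      volume.real (ivSet I ∩ Set.Ico α β) / len I ≤ 1 := by
    intro I hI
    have hl : 0 < len I := sub_pos.2 (hposI I hI)
    refine ⟨div_nonneg measureReal_nonneg hl.le, ?_⟩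
    rw [div_le_one hl, ← vol_iv (hposI I hI).le]
    exact measureReal_mono Set.inter_subset_left (iv_fin I)
  have havg : ∀ I ∈ S, ivSet I ⊆ ivSet L → δ ≤ len I →
      (0 ≤ avg (wgt k ch) I ∧ avg (wgt k ch) I ≤ 10 * b) ∧
      (0 ≤ avg (sgm p k ch) I ∧ avg (sgm p k ch) I ≤ b ^ (1 - p)) := by
    intro I hI hIL hd
    have hl : 0 < len I := sub_pos.2 (hposI I hI)
    unfold avg
    refine ⟨⟨div_nonneg (mass_nonneg hw0 I) hl.le, ?_⟩, ⟨div_nonneg (mass_nonneg hs0 I) hl.le, ?_⟩⟩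
    · rw [div_le_iff₀ hl]
      exact hmw I (hposI I hI) (hIL.trans hLK) (by linarith)
    · rw [div_le_iff₀ hl]
      exact hms I (hposI I hI) (hIL.trans hLK)
  constructor
  · refine le_trans (core hε hε1 hS L (wgt k ch) (sgm p k ch) hw0 hs0 hwi hsi p (by linarith) P hP
      δ (len K) ((10 : ℝ) ^ (p - 1) + 10) b α β hδ hδM hLM (by positivity) hb.le ?_
      (hcA _ _ hw0 hwi hwIJ)) (final_bound hk hε hε1 hlog (by positivity) (mass_nonneg hw0 L))
    intro I hI hIL hPI
    have hl : 0 < len I := sub_pos.2 (hposI I hI)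
    right
    rcases hdich I hI hIL hPI with hd | ⟨e1, e2⟩
    · left
      refine ⟨hd, ?_⟩
      obtain ⟨⟨a1, a2⟩, a3, a4⟩ := havg I hI hIL hd
      refine le_trans (term_big a1 a2 hp a3 a4 hl (m := mass (wgt k ch) I) ?_) ?_
      · unfold avg; field_simp
      · rw [ex1]
        have := mass_nonneg hw0 I
        gcongr
        linarith
    · right
      obtain ⟨t0, t1⟩ := hθ I hI
      have := term_small hb.le hbs.le t0 t1 hp hl
      rw [ex3] at this
      refine le_trans (le_of_eq ?_) this
      unfold avg
      rw [e1, e2, mul_div_assoc, mul_div_assoc]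
  · refine le_trans (core hε hε1 hS L (sgm p k ch) (wgt k ch) hs0 hw0 hsi hwi (p / (p - 1))
      (by linarith) P hP
      δ (len K) ((10 : ℝ) ^ (p - 1) + 10) (b ^ (1 - p)) α β hδ hδM hLM (by positivity) hbs.le ?_
      (hcA _ _ hs0 hsi hsIJ)) (final_bound hk hε hε1 hlog (by positivity) (mass_nonneg hs0 L))
    intro I hI hIL hPI
    have hl : 0 < len I := sub_pos.2 (hposI I hI)
    right
    rcases hdich I hI hIL hPI with hd | ⟨e1, e2⟩
    · left
      refine ⟨hd, ?_⟩
      obtain ⟨⟨a1, a2⟩, a3, a4⟩ := havg I hI hIL hd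
      refine le_trans (term_big a3 a4 hpq a1 a2 hl (m := mass (sgm p k ch) I) ?_) ?_
      · unfold avg; field_simp
      · rw [ex2]
        have := mass_nonneg hs0 I
        gcongr
        linarith
    · right
      obtain ⟨t0, t1⟩ := hθ I hI
      have := term_small hbs.le hb.le t0 t1 hpq hl
      rw [ex4] at this
      refine le_trans (le_of_eq ?_) this
      unfold avg
      rw [e1, e2, mul_div_assoc, mul_div_assoc]

/-- Lemma 4.8 of the paper: partial testing estimates over (a) intervals of `𝒮` inside `L`
of length at least `(1/3 - 3^{-k})|I(J)|`, and (b) intervals of `𝒮` inside `L` not contained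
in any member of `ch_𝐊(K)`; in both cases with bounds `C(p)·k·w_k(L)/(1-ε)` and
`C(p)·k·σ_k(L)/(1-ε)`. -/
theorem statement9 (p : ℝ) (hp : 1 < p) :
    ∃ C : ℝ, 0 < C ∧ ∀ k : ℕ, 3000 < k → ∀ ch : ℝ × ℝ → Bool,
      ∀ ε : ℝ, 0 < ε → ε < 1 → ∀ S : Set (ℝ × ℝ), MSparse ε S →
      (∀ I ∈ S, ivSet I ⊆ Set.Ico (0 : ℝ) 1) →
      ∀ K ∈ KK k, ∀ L : ℝ × ℝ, L.1 < L.2 → ivSet L ⊆ ivSet K →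
        ((sumTest p (wgt k ch) (sgm p k ch)
              {I | I ∈ S ∧ ivSet I ⊆ ivSet L ∧
                (1 / 3 - (3 : ℝ) ^ (-(k : ℤ))) * len (IJ k ch (mid K)) ≤ len I} ≤
            C * (k : ℝ) * mass (wgt k ch) L / (1 - ε) ∧
          sumTest (p / (p - 1)) (sgm p k ch) (wgt k ch)
              {I | I ∈ S ∧ ivSet I ⊆ ivSet L ∧
                (1 / 3 - (3 : ℝ) ^ (-(k : ℤ))) * len (IJ k ch (mid K)) ≤ len I} ≤
            C * (k : ℝ) * mass (sgm p k ch) L / (1 - ε)) ∧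
         (sumTest p (wgt k ch) (sgm p k ch)
              {I | I ∈ S ∧ ivSet I ⊆ ivSet L ∧ ∀ K' ∈ chK k K, ¬ ivSet I ⊆ ivSet K'} ≤
            C * (k : ℝ) * mass (wgt k ch) L / (1 - ε) ∧
          sumTest (p / (p - 1)) (sgm p k ch) (wgt k ch)
              {I | I ∈ S ∧ ivSet I ⊆ ivSet L ∧ ∀ K' ∈ chK k K, ¬ ivSet I ⊆ ivSet K'} ≤
            C * (k : ℝ) * mass (sgm p k ch) L / (1 - ε))) := by
  refine ⟨5 * ((10 : ℝ) ^ (p - 1) + 10) + 5, by positivity, ?_⟩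
  intro k hk ch ε hε hε1 S hS _ K hK L hL hLK
  obtain ⟨i, hKi⟩ := Set.mem_iUnion.1 hK
  constructor
  · exact both hp hk ch hε hε1 hS hKi L hL hLK
      (fun I => (1 / 3 - (3 : ℝ) ^ (-(k : ℤ))) * len (IJ k ch (mid K)) ≤ len I)
      (fun I hI Q _ h hIQ => h.trans (len_mono (hS.2.1 I hI) hIQ))
      (fun I _ h => Or.inl h)
  · exact both hp hk ch hε hε1 hS hKi L hL hLK
      (fun I => ∀ K' ∈ chK k K, ¬ ivSet I ⊆ ivSet K')
      (fun I _ Q _ h hIQ K' hK' hQ => h K' hK' (hIQ.trans hQ))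
      (fun I _ h => Or.inr h)

end RTpaper
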